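/- arXiv:1307.2481 — 3 statements merged into one kernel-verified Lean document; each statement's English description precedes it below -/
import Mathlib

section
/- Let k ≥ 2 be an integer, ε > 0 and c₁ ≥ 1. There exists a constant C = C(k,ε,c₁) > 0 such that for all real Z ≥ 2 and all reals X, Y ≥ 1 with max(X,Y) ≤ c₁·Z^{1/k} and X·Y ≥ Z^{14/(9k)}, one has N(X,Y,Z) ≤ C·Z^{14/(9k)+ε}. -/
/-- `Ncount k X Y Z` is the number of quadruples `(a,b,x,y)` of positive integers with
`a·x^k − b·y^k = 1`, `X < x ≤ 2X`, `Y < y ≤ 2Y` and `Z < b·y^k ≤ 2Z`. -/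
noncomputable def Ncount (k : ℕ) (X Y Z : ℝ) : ℕ :=
  {q : ℕ × ℕ × ℕ × ℕ | 0 < q.1 ∧ 0 < q.2.1 ∧ 0 < q.2.2.1 ∧ 0 < q.2.2.2 ∧
    (q.1 : ℤ) * (q.2.2.1 : ℤ) ^ k - (q.2.1 : ℤ) * (q.2.2.2 : ℤ) ^ k = 1 ∧
    X < (q.2.2.1 : ℝ) ∧ (q.2.2.1 : ℝ) ≤ 2 * X ∧
    Y < (q.2.2.2 : ℝ) ∧ (q.2.2.2 : ℝ) ≤ 2 * Y ∧
    Z < (q.2.1 : ℝ) * (q.2.2.2 : ℝ) ^ k ∧ (q.2.1 : ℝ) * (q.2.2.2 : ℝ) ^ k ≤ 2 * Z}.ncard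

theorem card_divisors_le_rpow (ε : ℝ) (hε : 0 < ε) :
    ∃ C : ℝ, 1 ≤ C ∧ ∀ n : ℕ, n ≠ 0 → (n.divisors.card : ℝ) ≤ C * (n : ℝ) ^ ε := by
  set B : ℝ := 1 + 1 / (ε * Real.log 2) with hB
  have hl2 : 0 < Real.log 2 := Real.log_pos (by norm_num)
  have hB1 : 1 ≤ B := by rw [hB]; linarith [show 0 < 1 / (ε * Real.log 2) by positivity]
  obtain ⟨P, hP⟩ := exists_nat_gt ((2 : ℝ) ^ (1 / ε))
  have key : ∀ p v : ℕ, p.Prime →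
      ((v : ℝ) + 1) ≤ (if p < P then B else 1) * ((p : ℝ) ^ v) ^ ε := by
    intro p v hp
    have hp2 : (2 : ℝ) ≤ p := by exact_mod_cast hp.two_le
    have hpv : ((p : ℝ) ^ v) ^ ε = ((p : ℝ) ^ ε) ^ v := by
      rw [← Real.rpow_natCast, ← Real.rpow_natCast, ← Real.rpow_mul (by positivity),
        ← Real.rpow_mul (by positivity), mul_comm]
    split_ifs with h
    · have h1 : ((2 : ℝ) ^ v) ^ ε ≤ ((p : ℝ) ^ v) ^ ε := by gcongr
      have h2 : (v : ℝ) * (ε * Real.log 2) + 1 ≤ ((2 : ℝ) ^ v) ^ ε := by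
        have : ((2 : ℝ) ^ v) ^ ε = Real.exp (v * (ε * Real.log 2)) := by
          rw [Real.rpow_def_of_pos (by positivity), Real.log_pow]; ring_nf
        rw [this]; exact Real.add_one_le_exp _
      have h3 : (v : ℝ) + 1 ≤ B * ((v : ℝ) * (ε * Real.log 2) + 1) := by
        have h4 : B * ((v : ℝ) * (ε * Real.log 2)) =
            (v : ℝ) * (ε * Real.log 2) + v := by rw [hB]; field_simp
        have h5 : 0 ≤ (v : ℝ) * (ε * Real.log 2) := by positivity
        linarith
      calc (v : ℝ) + 1 ≤ B * ((v : ℝ) * (ε * Real.log 2) + 1) := h3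
        _ ≤ B * ((p : ℝ) ^ v) ^ ε := by gcongr; exact h2.trans h1
    · have h1 : (2 : ℝ) ≤ (p : ℝ) ^ ε := by
        have h2 : (2 : ℝ) ^ (1 / ε) ≤ p := by
          push Not at h
          exact hP.le.trans (by exact_mod_cast h)
        calc (2 : ℝ) = ((2 : ℝ) ^ (1 / ε)) ^ ε := by
              rw [← Real.rpow_mul (by norm_num)]; field_simp; simp
          _ ≤ (p : ℝ) ^ ε := by gcongr
      rw [one_mul, hpv]
      have h3 : (v : ℝ) + 1 ≤ 2 ^ v := by exact_mod_cast Nat.lt_two_pow_self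
      exact h3.trans (by gcongr)
  refine ⟨B ^ P, one_le_pow₀ hB1, fun n hn => ?_⟩
  rw [Nat.card_divisors hn]
  have hn' : (n : ℝ) ^ ε = ∏ p ∈ n.primeFactors, ((p : ℝ) ^ (n.factorization p)) ^ ε := by
    rw [Real.finsetProd_rpow _ _ (fun i _ => by positivity)]
    congr 1
    conv_lhs => rw [← Nat.prod_factorization_pow_eq_self hn]
    rw [Finsupp.prod]; push_cast; rfl
  have h1 : ∏ p ∈ n.primeFactors, (if p < P then B else 1) ≤ B ^ P := by
    rw [Finset.prod_ite, Finset.prod_const, Finset.prod_const_one, mul_one]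
    apply pow_le_pow_right₀ hB1
    calc _ ≤ (Finset.range P).card := Finset.card_le_card (fun p hp => by
          simp only [Finset.mem_filter] at hp; exact Finset.mem_range.2 hp.2)
      _ = P := by simp
  push_cast
  calc ∏ p ∈ n.primeFactors, ((n.factorization p : ℝ) + 1)
      ≤ ∏ p ∈ n.primeFactors, ((if p < P then B else 1) *
          ((p : ℝ) ^ (n.factorization p)) ^ ε) := by
        apply Finset.prod_le_prod (fun i _ => by positivity)
        intro p hp
        exact key p _ (Nat.prime_of_mem_primeFactors hp)
    _ ≤ B ^ P * (n : ℝ) ^ ε := by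
        rw [Finset.prod_mul_distrib, ← hn']; gcongr

open MeasureTheory in
theorem exists_int_vec_abs_mulVec_lt {n : ℕ} (B : Matrix (Fin n) (Fin n) ℝ) (hB : B.det ≠ 0)
    (t : Fin n → ℝ) (ht : ∀ m, 0 < t m) (h : |B.det| < ∏ m, t m) :
    ∃ c : Fin n → ℤ, c ≠ 0 ∧ ∀ m, |B.mulVec (fun j => (c j : ℝ)) m| < t m := by
  set b := Pi.basisFun ℝ (Fin n)
  set L := (Submodule.span ℤ (Set.range b)).toAddSubgroup
  have fund : IsAddFundamentalDomain L (ZSpan.fundamentalDomain b) (volume : Measure (Fin n → ℝ)) :=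
    ZSpan.isAddFundamentalDomain b volume
  have : Countable L := inferInstanceAs (Countable (Submodule.span ℤ (Set.range b)))
  set box : Set (Fin n → ℝ) := Set.univ.pi (fun m => Set.Ioo (-(t m)) (t m))
  set s : Set (Fin n → ℝ) := (Matrix.toLin' B) ⁻¹' box with hs
  have hmem : ∀ x, x ∈ s ↔ ∀ m, |B.mulVec x m| < t m := by
    intro x
    simp [hs, box, abs_lt]
  have hdet : LinearMap.det (Matrix.toLin' B) = B.det := LinearMap.det_toLin' B
  have hvol : volume s = ENNReal.ofReal (|B.det|⁻¹ * ∏ m, (2 * t m)) := by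
    rw [hs, Measure.addHaar_preimage_linearMap _ (by rw [hdet]; exact hB), hdet,
      Real.volume_pi_Ioo, abs_inv, ENNReal.ofReal_mul (by positivity),
      ENNReal.ofReal_prod_of_nonneg (fun i _ => by have := ht i; positivity)]
    congr 2
    ext m; congr 1; ring
  have h2 : volume (ZSpan.fundamentalDomain b) * 2 ^ Module.finrank ℝ (Fin n → ℝ) < volume s := by
    rw [hvol, ZSpan.volume_fundamentalDomain]
    have : Matrix.of b = 1 := by
      ext i j; simp [b, Matrix.one_apply, Pi.single_apply, eq_comm]
    rw [this]
    simp only [Matrix.det_one, abs_one, ENNReal.ofReal_one, one_mul, Module.finrank_fin_fun]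
    rw [Finset.prod_mul_distrib, Finset.prod_const, Finset.card_univ, Fintype.card_fin]
    have h3 : (2 : ENNReal) ^ n = ENNReal.ofReal (2 ^ n) := by
      rw [ENNReal.ofReal_pow (by norm_num)]; simp
    rw [h3]
    apply (ENNReal.ofReal_lt_ofReal_iff_of_nonneg (by positivity)).2
    have hd : 0 < |B.det| := abs_pos.2 hB
    rw [inv_mul_eq_div, lt_div_iff₀ hd]
    gcongr
  obtain ⟨x, hx0, hx⟩ := exists_ne_zero_mem_lattice_of_measure_mul_two_pow_lt_measure fund
    (s := s) (fun x hx => by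
      rw [hmem] at hx ⊢
      intro m; rw [Matrix.mulVec_neg, Pi.neg_apply, abs_neg]; exact hx m)
    ((convex_pi (fun m _ => convex_Ioo _ _)).linear_preimage _) h2
  have hxL : (x : Fin n → ℝ) ∈ Submodule.span ℤ (Set.range b) := x.2
  rw [b.mem_span_iff_repr_mem ℤ] at hxL
  choose c hc using hxL
  have hxc : (x : Fin n → ℝ) = fun j => (c j : ℝ) := by
    ext j; have := hc j; simp [b] at this; exact this.symm
  refine ⟨c, ?_, ?_⟩
  · rintro rfl
    apply hx0
    ext j; rw [hxc]; simp
  · rw [← hxc]; exact (hmem _).1 hx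

theorem exists_small_exponential_sum {n : ℕ} (hn : 0 < n) (e : Fin n → ℕ)
    (he : Function.Injective e) :
    ∃ K : ℝ, 1 ≤ K ∧ ∀ s M l : ℝ, 0 < s → 1 ≤ M → 0 < l → (∀ j, (e j : ℝ) ≤ M) →
      K * ∏ j, s ^ e j < ∏ m : Fin n, (l * M ^ (m : ℕ)) →
      ∃ c : Fin n → ℤ, c ≠ 0 ∧ (∀ j, |(c j : ℝ)| * s ^ e j ≤ K * l * M ^ (n - 1)) ∧
        ∀ θ : ℝ, |θ| ≤ 1 / M → |∑ j, (c j : ℝ) * (s * Real.exp θ) ^ e j| ≤ K * l := by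
  set A : Matrix (Fin n) (Fin n) ℝ := (Matrix.vandermonde (fun j => (e j : ℝ))).transpose with hA
  have hdetA : A.det ≠ 0 := by
    rw [hA, Matrix.det_transpose, Matrix.det_vandermonde_ne_zero_iff]
    exact Nat.cast_injective.comp he
  set K1 : ℝ := ∑ j, ∑ m, |A⁻¹ j m| with hK1
  set E : ℝ := ∑ j, (e j : ℝ) ^ n with hE
  have hK1' : 0 ≤ K1 := by positivity
  have hE' : 0 ≤ E := by positivity
  refine ⟨1 + |A.det| + K1 + n + 2 * K1 * E, ?_, ?_⟩
  · have : 0 ≤ |A.det| + K1 + n + 2 * K1 * E := by positivity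
    linarith
  set K := 1 + |A.det| + K1 + n + 2 * K1 * E with hK
  intro s M l hs hM hl heM hprod
  set B := A * Matrix.diagonal (fun j => s ^ e j) with hB
  have hdetB : B.det = A.det * ∏ j, s ^ e j := by
    rw [hB, Matrix.det_mul, Matrix.det_diagonal]
  have hpos : 0 < ∏ j, s ^ e j := Finset.prod_pos (fun j _ => by positivity)
  obtain ⟨c, hc0, hc⟩ := exists_int_vec_abs_mulVec_lt B
    (by rw [hdetB]; exact mul_ne_zero hdetA hpos.ne') (fun m => l * M ^ (m : ℕ))
    (fun m => by positivity) (by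
      rw [hdetB, abs_mul, abs_of_pos hpos]
      refine lt_of_le_of_lt ?_ hprod
      gcongr
      have : 0 ≤ 1 + K1 + n + 2 * K1 * E := by positivity
      rw [hK]; linarith)
  set c' : Fin n → ℝ := fun j => (c j : ℝ) * s ^ e j with hc'
  have hBc : B.mulVec (fun j => (c j : ℝ)) = A.mulVec c' := by
    rw [hB, ← Matrix.mulVec_mulVec]
    congr 1; ext j; rw [Matrix.mulVec_diagonal, hc']; ring
  rw [hBc] at hc
  have hMpow : ∀ m : Fin n, M ^ (m : ℕ) ≤ M ^ (n - 1) := fun m =>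
    pow_le_pow_right₀ hM (by omega)
  have hcj : ∀ j, |c' j| ≤ K1 * l * M ^ (n - 1) := by
    intro j
    have h1 : c' = A⁻¹.mulVec (A.mulVec c') := by
      rw [Matrix.mulVec_mulVec, Matrix.nonsing_inv_mul _ (isUnit_iff_ne_zero.2 hdetA),
        Matrix.one_mulVec]
    have h2 : c' j = ∑ m, A⁻¹ j m * (A.mulVec c') m := by
      conv_lhs => rw [h1]
      rfl
    calc |c' j| ≤ ∑ m, |A⁻¹ j m * (A.mulVec c') m| := by
          rw [h2]; exact Finset.abs_sum_le_sum_abs _ _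
      _ ≤ ∑ m, |A⁻¹ j m| * (l * M ^ (n - 1)) := by
          apply Finset.sum_le_sum
          intro m _
          rw [abs_mul]
          gcongr
          exact (hc m).le.trans (mul_le_mul_of_nonneg_left (hMpow m) hl.le)
      _ = (∑ m, |A⁻¹ j m|) * (l * M ^ (n - 1)) := by rw [Finset.sum_mul]
      _ ≤ K1 * (l * M ^ (n - 1)) := by
          gcongr
          exact Finset.single_le_sum (f := fun j => ∑ m, |A⁻¹ j m|)
            (fun i _ => by positivity) (Finset.mem_univ j)
      _ = K1 * l * M ^ (n - 1) := by ring
  refine ⟨c, hc0, fun j => ?_, fun θ hθ => ?_⟩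
  · have h1 := hcj j
    rw [hc'] at h1
    simp only [abs_mul, abs_of_pos (show 0 < s ^ e j by positivity)] at h1
    refine h1.trans ?_
    gcongr
    have : 0 ≤ 1 + |A.det| + n + 2 * K1 * E := by positivity
    rw [hK]; linarith
  · have hM0 : 0 < M := by linarith
    set R : Fin n → ℝ := fun j => Real.exp (e j * θ) -
      ∑ m ∈ Finset.range n, (e j * θ) ^ m / m.factorial with hR
    have hRj : ∀ j, |R j| ≤ 2 * (e j : ℝ) ^ n * (1 / M) ^ n := by
      intro j
      have h0 : |(e j : ℝ) * θ| ≤ e j * (1 / M) := by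
        rw [abs_mul, Nat.abs_cast]; gcongr
      have h1 : |(e j : ℝ) * θ| ≤ 1 := by
        refine h0.trans ?_
        rw [mul_one_div, div_le_one hM0]; exact heM j
      refine (Real.exp_bound h1 hn).trans ?_
      have h2 : ((n.succ : ℝ) / (n.factorial * n)) ≤ 2 := by
        rw [div_le_iff₀ (by positivity)]
        have : (1 : ℝ) ≤ n.factorial := by exact_mod_cast n.factorial_pos
        have : (1 : ℝ) ≤ n := by exact_mod_cast hn
        push_cast; nlinarith
      calc _ ≤ (e j * (1 / M)) ^ n * 2 := by gcongr
        _ = _ := by ring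
    have hsum : ∑ j, (c j : ℝ) * (s * Real.exp θ) ^ e j =
        ∑ m : Fin n, θ ^ (m : ℕ) / (m : ℕ).factorial * (A.mulVec c') m + ∑ j, c' j * R j := by
      have h1 : ∀ m : Fin n, θ ^ (m : ℕ) / (m : ℕ).factorial * (A.mulVec c') m =
          ∑ j, c' j * ((e j * θ) ^ (m : ℕ) / (m : ℕ).factorial) := by
        intro m
        simp only [Matrix.mulVec, dotProduct, Finset.mul_sum, hA, Matrix.transpose_apply,
          Matrix.vandermonde_apply]
        refine Finset.sum_congr rfl fun j _ => ?_
        rw [mul_pow]; ring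
      rw [Finset.sum_congr rfl (fun m _ => h1 m), Finset.sum_comm, ← Finset.sum_add_distrib]
      refine Finset.sum_congr rfl fun j _ => ?_
      rw [← Finset.mul_sum, ← mul_add, hR]
      simp only
      rw [Fin.sum_univ_eq_sum_range (fun m => ((e j : ℝ) * θ) ^ m / (m.factorial : ℝ)),
        add_sub_cancel, mul_pow, ← Real.exp_nat_mul, hc']
      ring
    rw [hsum]
    have hfirst : |∑ m : Fin n, θ ^ (m : ℕ) / (m : ℕ).factorial * (A.mulVec c') m| ≤ n * l := by
      calc _ ≤ ∑ m : Fin n, |θ ^ (m : ℕ) / (m : ℕ).factorial * (A.mulVec c') m| :=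
            Finset.abs_sum_le_sum_abs _ _
        _ ≤ ∑ m : Fin n, l := by
            apply Finset.sum_le_sum
            intro m _
            have hf : (1 : ℝ) ≤ (m : ℕ).factorial := by exact_mod_cast (m : ℕ).factorial_pos
            rw [abs_mul, abs_div, abs_pow, Nat.abs_cast]
            calc _ ≤ ((1 / M) ^ (m : ℕ) / 1) * (l * M ^ (m : ℕ)) := by
                  gcongr
                  exact (hc m).le
              _ = l * (M⁻¹ * M) ^ (m : ℕ) := by rw [mul_pow, one_div]; ring
              _ = l := by rw [inv_mul_cancel₀ hM0.ne', one_pow, mul_one]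
        _ = n * l := by simp
    have hsecond : |∑ j, c' j * R j| ≤ 2 * K1 * E * l := by
      calc _ ≤ ∑ j, |c' j * R j| := Finset.abs_sum_le_sum_abs _ _
        _ ≤ ∑ j, 2 * K1 * l * (e j : ℝ) ^ n := by
            apply Finset.sum_le_sum
            intro j _
            rw [abs_mul]
            calc _ ≤ (K1 * l * M ^ (n - 1)) * (2 * (e j : ℝ) ^ n * (1 / M) ^ n) := by
                  gcongr
                  · exact hcj j
                  · exact hRj j
              _ = 2 * K1 * l * (e j : ℝ) ^ n * (M ^ (n - 1) * (1 / M) ^ n) := by ring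
              _ ≤ 2 * K1 * l * (e j : ℝ) ^ n * 1 := by
                  gcongr
                  rw [one_div, inv_pow, ← div_eq_mul_inv, div_le_one (by positivity)]
                  exact pow_le_pow_right₀ hM (by omega)
              _ = _ := by ring
        _ = 2 * K1 * E * l := by rw [← Finset.mul_sum, hE]; ring
    calc _ ≤ n * l + 2 * K1 * E * l := (abs_add_le _ _).trans (add_le_add hfirst hsecond)
      _ ≤ K * l := by
          rw [← add_mul]
          gcongr
          have : 0 ≤ 1 + |A.det| + K1 := by positivity
          rw [hK]; linarith

attribute [local instance] Matrix.seminormedAddCommGroup in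
theorem exists_bounded_kernel_vec {N : ℕ} (hN : 2 ≤ N) (M : Matrix (Fin N) (Fin N) ℤ)
    (hdet : M.det = 0) (H : ℝ) (hH : 1 ≤ H) (hM : ∀ i j, |(M i j : ℝ)| ≤ H) :
    ∃ t : Fin N → ℤ, t ≠ 0 ∧ M.mulVec t = 0 ∧ ∀ j, |(t j : ℝ)| ≤ (N * H) ^ N := by
  obtain ⟨w, hw0, hw⟩ := Matrix.exists_vecMul_eq_zero_iff.2 hdet
  obtain ⟨i₀, hi₀⟩ := Function.ne_iff.1 hw0
  set M' : Matrix {i : Fin N // i ≠ i₀} (Fin N) ℤ := fun i j => M i j with hM'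
  have hcard : Fintype.card {i : Fin N // i ≠ i₀} = N - 1 := by simp
  obtain ⟨t, ht0, ht, htn⟩ := Int.Matrix.exists_ne_zero_int_vec_norm_le M'
    (by rw [hcard, Fintype.card_fin]; omega) (by rw [hcard]; omega)
  have hoff : ∀ i, i ≠ i₀ → M.mulVec t i = 0 := fun i hi => congrFun ht ⟨i, hi⟩
  refine ⟨t, ht0, ?_, fun j => ?_⟩
  · ext i
    by_cases hi : i = i₀
    · subst hi
      have h1 : dotProduct w (M.mulVec t) = 0 := by
        rw [Matrix.dotProduct_mulVec, hw, zero_dotProduct]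
      rw [dotProduct, Finset.sum_eq_single i (fun b _ hb => by rw [hoff b hb, mul_zero])
        (by simp)] at h1
      exact (mul_eq_zero.1 h1).resolve_left hi₀
    · exact hoff i hi
  · have hnorm : ‖M'‖ ≤ H := by
      rw [Matrix.norm_le_iff (by linarith)]
      intro i k
      rw [Int.norm_eq_abs]
      exact hM i k
    have h1 : |(t j : ℝ)| ≤ ‖t‖ := by
      rw [← Int.norm_eq_abs]; exact norm_le_pi_norm t j
    refine h1.trans (htn.trans ?_)
    rw [hcard, Fintype.card_fin]
    have hN' : ((N - 1 : ℕ) : ℝ) = N - 1 := by rw [Nat.cast_sub (by omega)]; simp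
    have h2 : (((N - 1 : ℕ) : ℝ) / ((N : ℝ) - ((N - 1 : ℕ) : ℝ))) ≤ N := by
      rw [hN']; simp
    have hN1 : (1 : ℝ) ≤ N := by exact_mod_cast (by omega : 1 ≤ N)
    have h3 : max 1 ‖M'‖ ≤ H := max_le hH hnorm
    have h4 : (1 : ℝ) ≤ N * max 1 ‖M'‖ := one_le_mul_of_one_le_of_one_le hN1 (le_max_left _ _)
    calc _ ≤ ((N : ℝ) * max 1 ‖M'‖) ^ (N : ℝ) := Real.rpow_le_rpow_of_exponent_le h4 h2
      _ = ((N : ℝ) * max 1 ‖M'‖) ^ N := Real.rpow_natCast _ _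
      _ ≤ _ := by gcongr

/-- The value at `(x, y)` of the binary form of degree `D` with coefficients `g`. -/
def binForm (D : ℕ) (g : ℕ → ℤ) (x y : ℤ) : ℤ :=
  ∑ i ∈ Finset.range (D + 1), g i * x ^ i * y ^ (D - i)

/-- The Sylvester matrix of two binary forms of degree `D`. -/
def sylv (D : ℕ) (g₁ g₂ : ℕ → ℤ) : Matrix (Fin (D + D)) (Fin (D + D)) ℤ := fun r j =>
  if (j : ℕ) < D then
    (if (j : ℕ) ≤ r ∧ (r : ℕ) ≤ j + D then g₁ (r - j) else 0)
  else
    (if (j : ℕ) - D ≤ r ∧ (r : ℕ) ≤ (j - D) + D then g₂ (r - (j - D)) else 0)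

theorem sum_monomial_shift (D i : ℕ) (hi : i < D) (g : ℕ → ℤ) (x y : ℤ) :
    ∑ r : Fin (D + D), x ^ (r : ℕ) * y ^ (D + D - 1 - r) *
      (if i ≤ (r : ℕ) ∧ (r : ℕ) ≤ i + D then g (r - i) else 0) =
    x ^ i * y ^ (D - 1 - i) * binForm D g x y := by
  rw [Fin.sum_univ_eq_sum_range (fun r => x ^ r * y ^ (D + D - 1 - r) *
      (if i ≤ r ∧ r ≤ i + D then g (r - i) else 0))]
  simp only [mul_ite, mul_zero]
  rw [← Finset.sum_filter, binForm, Finset.mul_sum]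
  symm
  apply Finset.sum_bij (fun l _ => i + l)
  · intro l hl
    simp only [Finset.mem_range, Finset.mem_filter] at hl ⊢
    omega
  · intro a _ b _ h; omega
  · intro r hr
    simp only [Finset.mem_range, Finset.mem_filter] at hr
    exact ⟨r - i, by simp only [Finset.mem_range]; omega, by omega⟩
  · intro l hl
    simp only [Finset.mem_range] at hl
    rw [show D + D - 1 - (i + l) = (D - 1 - i) + (D - l) by omega,
      show i + l - i = l by omega, pow_add, pow_add]
    ring

theorem vecMul_sylv (D : ℕ) (g₁ g₂ : ℕ → ℤ) (x y : ℤ) (j : Fin (D + D)) :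
    Matrix.vecMul (fun r : Fin (D + D) => x ^ (r : ℕ) * y ^ (D + D - 1 - r)) (sylv D g₁ g₂) j =
      if (j : ℕ) < D then x ^ (j : ℕ) * y ^ (D - 1 - j) * binForm D g₁ x y
      else x ^ ((j : ℕ) - D) * y ^ (D - 1 - (j - D)) * binForm D g₂ x y := by
  simp only [Matrix.vecMul, dotProduct, sylv]
  split_ifs with h
  · exact sum_monomial_shift D j h g₁ x y
  · exact sum_monomial_shift D (j - D) (by omega) g₂ x y

theorem dvd_det_sylv (D : ℕ) (hD : 1 ≤ D) (g₁ g₂ : ℕ → ℤ) (x y ρ : ℤ) (hxy : IsCoprime x y)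
    (h₁ : ρ ∣ binForm D g₁ x y) (h₂ : ρ ∣ binForm D g₂ x y) : ρ ∣ (sylv D g₁ g₂).det := by
  set w : Fin (D + D) → ℤ := fun r => x ^ (r : ℕ) * y ^ (D + D - 1 - r) with hw
  have hdvd : ∀ j, ρ ∣ Matrix.vecMul w (sylv D g₁ g₂) j := by
    intro j
    rw [hw, vecMul_sylv]
    split_ifs
    · exact h₁.mul_left _
    · exact h₂.mul_left _
  have hdet : ∀ r, ρ ∣ (sylv D g₁ g₂).det * w r := by
    intro r
    have h3 : Matrix.vecMul (Matrix.vecMul w (sylv D g₁ g₂)) (sylv D g₁ g₂).adjugate r =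
        (sylv D g₁ g₂).det * w r := by
      rw [Matrix.vecMul_vecMul, Matrix.mul_adjugate, Matrix.vecMul_smul, Matrix.vecMul_one]
      rfl
    rw [← h3, Matrix.vecMul, dotProduct]
    exact Finset.dvd_sum fun j _ => (hdvd j).mul_right _
  have hy := hdet ⟨0, by omega⟩
  have hx := hdet ⟨D + D - 1, by omega⟩
  simp only [hw, pow_zero, one_mul, Nat.sub_zero, Nat.sub_self, mul_one] at hx hy
  obtain ⟨u, v, huv⟩ : IsCoprime (x ^ (D + D - 1)) (y ^ (D + D - 1)) := hxy.pow
  have : (sylv D g₁ g₂).det = (sylv D g₁ g₂).det * x ^ (D + D - 1) * u +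
      (sylv D g₁ g₂).det * y ^ (D + D - 1) * v := by
    linear_combination -(sylv D g₁ g₂).det * huv
  rw [this]
  exact dvd_add (hx.mul_right _) (hy.mul_right _)

theorem abs_sylv_le (D : ℕ) (g₁ g₂ : ℕ → ℤ) (H : ℝ) (hH : 0 ≤ H) (h₁ : ∀ i ≤ D, |(g₁ i : ℝ)| ≤ H)
    (h₂ : ∀ i ≤ D, |(g₂ i : ℝ)| ≤ H) (r j : Fin (D + D)) : |(sylv D g₁ g₂ r j : ℝ)| ≤ H := by
  unfold sylv
  split_ifs
  · exact h₁ _ (by omega)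
  · simpa using hH
  · exact h₂ _ (by omega)
  · simpa using hH

theorem abs_det_sylv_le (D : ℕ) (g₁ g₂ : ℕ → ℤ) (H : ℝ) (hH : 0 ≤ H)
    (h₁ : ∀ i ≤ D, |(g₁ i : ℝ)| ≤ H) (h₂ : ∀ i ≤ D, |(g₂ i : ℝ)| ≤ H) :
    |((sylv D g₁ g₂).det : ℝ)| ≤ (D + D).factorial * H ^ (D + D) := by
  have h := Matrix.det_le (A := (sylv D g₁ g₂).map (fun z : ℤ => (z : ℝ)))
    (abv := IsAbsoluteValue.toAbsoluteValue (abs : ℝ → ℝ)) (x := H)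
    (fun i j => abs_sylv_le D g₁ g₂ H hH h₁ h₂ i j)
  have h2 : ((sylv D g₁ g₂).map (fun z : ℤ => (z : ℝ))).det = ((sylv D g₁ g₂).det : ℝ) :=
    (RingHom.map_det (Int.castRingHom ℝ) _).symm
  rw [h2] at h
  simpa [nsmul_eq_mul] using h

/-- A singular Sylvester matrix yields a nontrivial bounded syzygy of degree one less. -/
theorem exists_syzygy_of_det_sylv_eq_zero (D : ℕ) (g₁ g₂ : ℕ → ℤ) (H : ℝ)
    (hH : 1 ≤ H) (h₁ : ∀ i ≤ D + 1, |(g₁ i : ℝ)| ≤ H) (h₂ : ∀ i ≤ D + 1, |(g₂ i : ℝ)| ≤ H)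
    (hdet : (sylv (D + 1) g₁ g₂).det = 0) :
    ∃ p q : ℕ → ℤ, (∃ i ≤ D, p i ≠ 0 ∨ q i ≠ 0) ∧
      (∀ i ≤ D, |(p i : ℝ)| ≤ (((D + 1 + (D + 1) : ℕ) : ℝ) * H) ^ (D + 1 + (D + 1))) ∧
      (∀ i ≤ D, |(q i : ℝ)| ≤ (((D + 1 + (D + 1) : ℕ) : ℝ) * H) ^ (D + 1 + (D + 1))) ∧
      ∀ x y : ℤ, binForm D p x y * binForm (D + 1) g₁ x y +
        binForm D q x y * binForm (D + 1) g₂ x y = 0 := by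
  obtain ⟨t, ht0, ht, htn⟩ := exists_bounded_kernel_vec (by omega) _ hdet H hH
    (abs_sylv_le (D + 1) g₁ g₂ H (by linarith) h₁ h₂)
  set p : ℕ → ℤ := fun i => if h : i < D + 1 then t (Fin.castAdd (D + 1) ⟨i, h⟩) else 0 with hp
  set q : ℕ → ℤ := fun i => if h : i < D + 1 then t (Fin.natAdd (D + 1) ⟨i, h⟩) else 0 with hq
  refine ⟨p, q, ?_, ?_, ?_, ?_⟩
  · by_contra! hcon
    apply ht0
    ext j
    refine Fin.addCases (fun i => ?_) (fun i => ?_) j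
    · have := (hcon i (by omega)).1
      simp only [hp, i.2, dif_pos] at this
      exact this
    · have := (hcon i (by omega)).2
      simp only [hq, i.2, dif_pos] at this
      exact this
  · intro i hi
    simp only [hp, show i < D + 1 by omega, dif_pos]
    exact htn _
  · intro i hi
    simp only [hq, show i < D + 1 by omega, dif_pos]
    exact htn _
  · intro x y
    have h := congrArg (dotProduct (fun r : Fin (D + 1 + (D + 1)) =>
      x ^ (r : ℕ) * y ^ (D + 1 + (D + 1) - 1 - r))) ht
    rw [Matrix.dotProduct_mulVec, dotProduct_zero, dotProduct, Fin.sum_univ_add] at h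
    simp only [vecMul_sylv] at h
    rw [← h]
    have e1 : binForm D p x y = ∑ i : Fin (D + 1), p i * x ^ (i : ℕ) * y ^ (D - i) := by
      rw [binForm, Fin.sum_univ_eq_sum_range (fun i => p i * x ^ i * y ^ (D - i))]
    have e2 : binForm D q x y = ∑ i : Fin (D + 1), q i * x ^ (i : ℕ) * y ^ (D - i) := by
      rw [binForm, Fin.sum_univ_eq_sum_range (fun i => q i * x ^ i * y ^ (D - i))]
    rw [e1, e2, Finset.sum_mul, Finset.sum_mul]
    congr 1
    · refine Finset.sum_congr rfl fun i _ => ?_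
      simp only [hp, i.2, dif_pos, Fin.val_castAdd, if_true, Nat.add_sub_cancel, Fin.eta]
      ring
    · refine Finset.sum_congr rfl fun i _ => ?_
      simp only [hq, i.2, dif_pos, Fin.val_natAdd, Nat.add_sub_cancel, Fin.eta,
        show ¬ (D + 1 + (i : ℕ) < D + 1) by omega, if_false, Nat.add_sub_cancel_left]
      ring

open Polynomial in
theorem mul_pow_sub_X_pow_mul_ne_C {k D : ℕ} (hD : D + 2 ≤ k) (A B : ℚ[X]) (r s ρ : ℚ)
    (hρ : ρ ≠ 0) (hA : A.natDegree ≤ D) (hB0 : B ≠ 0) (hA0 : A ≠ 0) :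
    (C r + C s * X) ^ k * A - X ^ k * B ≠ C ρ := by
  intro h
  have hk : k ≠ 0 := by omega
  have hr : r ≠ 0 := by
    rintro rfl
    have := congrArg (eval 0) h
    simp [hk] at this
    exact hρ this.symm
  by_cases hs : s = 0
  · subst hs
    have h1 : X ^ k * B = C r ^ k * A - C ρ := by
      rw [← h]; simp
    have h2 : (X ^ k * B).natDegree ≤ D := by
      rw [h1]
      refine (natDegree_sub_le _ _).trans (max_le ?_ (by simp))
      rw [← C_pow]
      exact (natDegree_C_mul_le _ _).trans hA
    rw [natDegree_mul (pow_ne_zero _ X_ne_zero) hB0, natDegree_X_pow] at h2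
    omega
  · set q : ℚ[X] := C r + C s * X with hq
    have hq' : derivative q = C s := by simp [hq]
    obtain ⟨l, rfl⟩ : ∃ l, k = l + 1 := ⟨k - 1, by omega⟩
    have h1 := congrArg derivative h
    rw [derivative_sub, derivative_mul, derivative_mul, derivative_C, derivative_pow_succ,
      derivative_X_pow, hq'] at h1
    set F : ℚ[X] := C ((l : ℚ) + 1) * C s * A + q * derivative A with hF
    have h2 : q ^ l * F = X ^ l * (C ((l : ℚ) + 1) * B + X * derivative B) := by
      rw [hF]
      simp only [Nat.add_sub_cancel] at h1
      push_cast at h1 ⊢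
      linear_combination h1
    have hcop : IsCoprime (X ^ l) (q ^ l) := by
      apply IsCoprime.pow
      refine ⟨-C (r⁻¹ * s), C r⁻¹, ?_⟩
      rw [hq, mul_add, ← mul_assoc, ← C_mul, ← C_mul, inv_mul_cancel₀ hr, C_1]
      ring
    have h3 : X ^ l ∣ F := hcop.dvd_of_dvd_mul_left (Dvd.intro _ h2.symm)
    have hqd : q.natDegree = 1 := by
      rw [hq, add_comm]; exact natDegree_linear hs
    have hq0 : q ≠ 0 := by rintro h0; rw [h0] at hqd; simp at hqd
    have hFd : F.natDegree ≤ D := by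
      rw [hF]
      refine (natDegree_add_le _ _).trans (max_le ?_ ?_)
      · rw [← C_mul]; exact (natDegree_C_mul_le _ _).trans hA
      · by_cases hA' : derivative A = 0
        · simp [hA']
        · refine natDegree_mul_le.trans ?_
          rw [hqd]
          have : A.natDegree ≠ 0 := by
            intro h0
            exact hA' (by rw [eq_C_of_natDegree_eq_zero h0]; simp)
          have := natDegree_derivative_lt this
          omega
    have hF0 : F = 0 := by
      by_contra hF0
      have := natDegree_le_of_dvd h3 hF0
      rw [natDegree_X_pow] at this
      omega
    have h4 : derivative (q ^ (l + 1) * A) = 0 := by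
      rw [derivative_mul, derivative_pow_succ, hq']
      linear_combination q ^ l * (hF.symm.trans hF0)
    have h5 := derivative_eq_zero.1 h4
    rw [natDegree_mul (pow_ne_zero _ hq0) hA0, natDegree_pow, hqd] at h5
    omega

/-- The predicate that `q = (a, b, x, y)` is a positive solution of `a x ^ k - b y ^ k = 1`. -/
def IsSol (k : ℕ) (q : ℕ × ℕ × ℕ × ℕ) : Prop :=
  0 < q.1 ∧ 0 < q.2.1 ∧ 0 < q.2.2.1 ∧ 0 < q.2.2.2 ∧
    (q.1 : ℤ) * (q.2.2.1 : ℤ) ^ k - (q.2.1 : ℤ) * (q.2.2.2 : ℤ) ^ k = 1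

theorem IsSol.isCoprime {k : ℕ} (hk : k ≠ 0) {q : ℕ × ℕ × ℕ × ℕ} (h : IsSol k q) :
    IsCoprime (q.2.2.1 : ℤ) (q.2.2.2 : ℤ) := by
  have h1 : IsCoprime ((q.2.2.1 : ℤ) ^ k) ((q.2.2.2 : ℤ) ^ k) :=
    ⟨q.1, -q.2.1, by linear_combination h.2.2.2.2⟩
  exact (IsCoprime.pow_iff (Nat.pos_of_ne_zero hk) (Nat.pos_of_ne_zero hk)).1 h1

open Polynomial in
theorem card_line_le {k D : ℕ} (hD : D + 2 ≤ k) (g₁ g₂ : ℕ → ℤ) (ρ m u v : ℤ) (hρ : ρ ≠ 0)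
    (hu : u ≠ 0) (P : Finset (ℕ × ℕ × ℕ × ℕ))
    (hinj : Set.InjOn (fun q : ℕ × ℕ × ℕ × ℕ => q.2.2) P)
    (hP : ∀ q ∈ P, 0 < q.1 ∧ 0 < q.2.1 ∧ ρ * q.1 = binForm D g₂ q.2.2.1 q.2.2.2 ∧
      ρ * q.2.1 = binForm D g₁ q.2.2.1 q.2.2.2 ∧ u * q.2.2.1 + v * q.2.2.2 = m ∧
      (q.2.2.1 : ℤ) ^ k * binForm D g₂ q.2.2.1 q.2.2.2 -
        (q.2.2.2 : ℤ) ^ k * binForm D g₁ q.2.2.1 q.2.2.2 = ρ) :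
    P.card ≤ k + D := by
  rcases P.eq_empty_or_nonempty with rfl | ⟨q₀, hq₀⟩
  · simp
  have huq : (u : ℚ) ≠ 0 := by exact_mod_cast hu
  set L : ℚ[X] := C ((m : ℚ) / u) + C (-(v : ℚ) / u) * X with hL
  set form : (ℕ → ℤ) → ℚ[X] := fun g =>
    ∑ i ∈ Finset.range (D + 1), C (g i : ℚ) * L ^ i * X ^ (D - i) with hform
  have hLd : L.natDegree ≤ 1 := by
    rw [hL, add_comm]; exact natDegree_linear_le
  have hdeg : ∀ g, (form g).natDegree ≤ D := by
    intro g
    refine natDegree_sum_le_of_forall_le _ _ fun i hi => ?_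
    rw [Finset.mem_range] at hi
    refine natDegree_mul_le.trans ?_
    rw [natDegree_X_pow]
    have h1 := (natDegree_C_mul_le (g i : ℚ) (L ^ i)).trans (natDegree_pow_le_of_le i hLd)
    omega
  have hLe : ∀ q ∈ P, L.eval (q.2.2.2 : ℚ) = q.2.2.1 := by
    intro q hq
    have h := (hP q hq).2.2.2.2.1
    have h' : (u : ℚ) * q.2.2.1 + v * q.2.2.2 = m := by exact_mod_cast h
    simp [hL]
    field_simp
    linarith
  have heval : ∀ g, ∀ q ∈ P, (form g).eval (q.2.2.2 : ℚ) =
      ((binForm D g q.2.2.1 q.2.2.2 : ℤ) : ℚ) := by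
    intro g q hq
    simp [hform, eval_finsetSum, hLe q hq, binForm]
  set p : ℚ[X] := L ^ k * form g₂ - X ^ k * form g₁ - C (ρ : ℚ) with hp
  have hne : ∀ g, ((binForm D g q₀.2.2.1 q₀.2.2.2 : ℤ)) ≠ 0 → form g ≠ 0 := by
    intro g hg h0
    have := heval g q₀ hq₀
    rw [h0, eval_zero] at this
    exact hg (by exact_mod_cast this.symm)
  obtain ⟨ha, hb, h1, h2, -, -⟩ := hP q₀ hq₀
  have hp0 : p ≠ 0 := by
    rw [hp, sub_ne_zero]
    apply mul_pow_sub_X_pow_mul_ne_C hD _ _ _ _ _ (by exact_mod_cast hρ) (hdeg g₂)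
    · apply hne; rw [← h2]; exact mul_ne_zero hρ (by exact_mod_cast hb.ne')
    · apply hne; rw [← h1]; exact mul_ne_zero hρ (by exact_mod_cast ha.ne')
  have hpd : p.natDegree ≤ k + D := by
    rw [hp]
    refine (natDegree_sub_le _ _).trans (max_le ?_ (by simp))
    refine (natDegree_sub_le _ _).trans (max_le ?_ ?_)
    · refine natDegree_mul_le.trans ?_
      have := natDegree_pow_le_of_le k hLd
      have := hdeg g₂
      omega
    · refine natDegree_mul_le.trans ?_
      rw [natDegree_X_pow]
      have := hdeg g₁
      omega
  have hcard : P.card ≤ p.roots.toFinset.card := by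
    apply Finset.card_le_card_of_injOn (fun q => (q.2.2.2 : ℚ))
    · intro q hq
      have hq' : q ∈ P := hq
      simp only [Finset.mem_coe, Multiset.mem_toFinset, mem_roots hp0, IsRoot.def]
      have h3 := (hP q hq').2.2.2.2.2
      rw [hp]
      simp only [eval_sub, eval_mul, eval_pow, eval_X, eval_C, hLe q hq', heval _ q hq']
      rw [← h3]; push_cast; ring
    · intro q hq q' hq' h
      have hy : q.2.2.2 = q'.2.2.2 := Nat.cast_injective (R := ℚ) h
      apply hinj hq hq'
      have h3 := (hP q hq).2.2.2.2.1
      have h4 := (hP q' hq').2.2.2.2.1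
      rw [← hy, ← h3] at h4
      have h5 : u * (q'.2.2.1 : ℤ) = u * q.2.2.1 := by linarith
      have h6 : q'.2.2.1 = q.2.2.1 := by exact_mod_cast mul_left_cancel₀ hu h5
      exact Prod.ext h6.symm hy
  exact hcard.trans ((Multiset.toFinset_card_le _).trans ((card_roots' p).trans hpd))

open Polynomial in
theorem card_zeros_le {k D : ℕ} (hk : k ≠ 0) (g : ℕ → ℤ) (hg : ∃ i ≤ D, g i ≠ 0)
    (P : Finset (ℕ × ℕ × ℕ × ℕ))
    (hinj : Set.InjOn (fun q : ℕ × ℕ × ℕ × ℕ => q.2.2) P) (hsol : ∀ q ∈ P, IsSol k q)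
    (hP : ∀ q ∈ P, binForm D g q.2.2.1 q.2.2.2 = 0) : P.card ≤ D := by
  set p : ℚ[X] := ∑ i ∈ Finset.range (D + 1), C (g i : ℚ) * X ^ i with hp
  have hp0 : p ≠ 0 := by
    obtain ⟨i, hi, hgi⟩ := hg
    intro h
    have := congrArg (fun f => coeff f i) h
    simp [hp, coeff_X_pow] at this
    exact hgi (this (by omega))
  have hpd : p.natDegree ≤ D := by
    refine natDegree_sum_le_of_forall_le _ _ fun i hi => ?_
    rw [Finset.mem_range] at hi
    exact (natDegree_C_mul_X_pow_le _ _).trans (by omega)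
  have hcard : P.card ≤ p.roots.toFinset.card := by
    apply Finset.card_le_card_of_injOn (fun q => ((q.2.2.1 : ℤ) : ℚ) / ((q.2.2.2 : ℤ) : ℚ))
    · intro q hq
      have hy : ((q.2.2.2 : ℤ) : ℚ) ≠ 0 := by exact_mod_cast (hsol q hq).2.2.2.1.ne'
      simp only [Finset.mem_coe, Multiset.mem_toFinset, mem_roots hp0, IsRoot.def]
      have h3 := hP q hq
      have h4 : p.eval (((q.2.2.1 : ℤ) : ℚ) / ((q.2.2.2 : ℤ) : ℚ)) * ((q.2.2.2 : ℤ) : ℚ) ^ D =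
          ((binForm D g q.2.2.1 q.2.2.2 : ℤ) : ℚ) := by
        rw [hp, eval_finsetSum, Finset.sum_mul, binForm]
        push_cast
        refine Finset.sum_congr rfl fun i hi => ?_
        rw [Finset.mem_range] at hi
        simp only [eval_mul, eval_C, eval_pow, eval_X, div_pow]
        rw [show D = (D - i) + i by omega, pow_add, Nat.add_sub_cancel]
        push_cast at hy
        field_simp
      rw [h3, Int.cast_zero] at h4
      exact (mul_eq_zero.1 h4).resolve_right (pow_ne_zero _ hy)
    · intro q hq q' hq' h
      have h1 := (hsol q hq).isCoprime hk
      have h2 := (hsol q' hq').isCoprime hk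
      have h3 := Rat.div_int_inj (by exact_mod_cast (hsol q hq).2.2.2.1)
        (by exact_mod_cast (hsol q' hq').2.2.2.1) (Int.isCoprime_iff_gcd_eq_one.1 h1)
        (Int.isCoprime_iff_gcd_eq_one.1 h2) h
      exact hinj hq hq' (Prod.ext (by exact_mod_cast h3.1) (by exact_mod_cast h3.2))
  exact hcard.trans ((Multiset.toFinset_card_le _).trans ((card_roots' p).trans hpd))

/-- The difference `x ^ k * G₂(x, y) - y ^ k * G₁(x, y)` attached to two binary forms. -/
def cross (k D : ℕ) (g₁ g₂ : ℕ → ℤ) (x y : ℤ) : ℤ :=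
  x ^ k * binForm D g₂ x y - y ^ k * binForm D g₁ x y

theorem IsSol.mul_cross {k D : ℕ} {g₁ g₂ : ℕ → ℤ} {q : ℕ × ℕ × ℕ × ℕ} (h : IsSol k q)
    (hab : (q.1 : ℤ) * binForm D g₁ q.2.2.1 q.2.2.2 = q.2.1 * binForm D g₂ q.2.2.1 q.2.2.2) :
    cross k D g₁ g₂ q.2.2.1 q.2.2.2 * q.1 = binForm D g₂ q.2.2.1 q.2.2.2 ∧
      cross k D g₁ g₂ q.2.2.1 q.2.2.2 * q.2.1 = binForm D g₁ q.2.2.1 q.2.2.2 := by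
  have h1 := h.2.2.2.2
  rw [cross]
  constructor
  · linear_combination binForm D g₂ q.2.2.1 q.2.2.2 * h1 - (q.2.2.2 : ℤ) ^ k * hab
  · linear_combination binForm D g₁ q.2.2.1 q.2.2.2 * h1 - (q.2.2.1 : ℤ) ^ k * hab

theorem card_slab_le {k D : ℕ} (hD : D + 2 ≤ k) (g₁ g₂ : ℕ → ℤ) (R : ℤ) (hR : R ≠ 0) (u v : ℤ)
    (hu : u ≠ 0) (T : ℝ) (hT : 0 ≤ T) (P : Finset (ℕ × ℕ × ℕ × ℕ))
    (hinj : Set.InjOn (fun q : ℕ × ℕ × ℕ × ℕ => q.2.2) P) (hsol : ∀ q ∈ P, IsSol k q)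
    (hlin : ∀ q ∈ P, |((u * q.2.2.1 + v * q.2.2.2 : ℤ) : ℝ)| ≤ T)
    (hab : ∀ q ∈ P, (q.1 : ℤ) * binForm D g₁ q.2.2.1 q.2.2.2 =
      q.2.1 * binForm D g₂ q.2.2.1 q.2.2.2)
    (hdvd : ∀ q ∈ P, cross k D g₁ g₂ q.2.2.1 q.2.2.2 ∣ R) :
    (P.card : ℝ) ≤ (k + D) * (2 * R.natAbs.divisors.card * (2 * T + 1)) := by
  classical
  set S : Finset ℤ := R.natAbs.divisors.image (fun d : ℕ => (d : ℤ)) ∪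
    R.natAbs.divisors.image (fun d : ℕ => -(d : ℤ)) with hS
  set I : Finset ℤ := Finset.Icc (-⌊T⌋) ⌊T⌋ with hI
  have hScard : S.card ≤ 2 * R.natAbs.divisors.card := by
    rw [two_mul]
    exact (Finset.card_union_le _ _).trans (add_le_add Finset.card_image_le Finset.card_image_le)
  have hIcard : (I.card : ℝ) ≤ 2 * T + 1 := by
    have h1 : ((I.card : ℤ) : ℝ) = ((⌊T⌋ + 1 - -⌊T⌋ : ℤ) : ℝ) := by
      rw [hI, Int.card_Icc, Int.toNat_of_nonneg]
      have := Int.floor_nonneg.2 hT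
      omega
    have h2 := Int.floor_le T
    push_cast at h1
    linarith
  have hmem : ∀ q ∈ P, (cross k D g₁ g₂ q.2.2.1 q.2.2.2,
      u * (q.2.2.1 : ℤ) + v * q.2.2.2) ∈ S ×ˢ I := by
    intro q hq
    rw [Finset.mem_product]
    constructor
    · have h1 := Int.natAbs_dvd_natAbs.2 (hdvd q hq)
      have h2 : (cross k D g₁ g₂ q.2.2.1 q.2.2.2).natAbs ∈ R.natAbs.divisors :=
        Nat.mem_divisors.2 ⟨h1, by simpa using hR⟩
      simp only [hS, Finset.mem_union, Finset.mem_image]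
      rcases Int.natAbs_eq (cross k D g₁ g₂ q.2.2.1 q.2.2.2) with h | h
      · exact Or.inl ⟨_, h2, h.symm⟩
      · exact Or.inr ⟨_, h2, h.symm⟩
    · have h1 := abs_le.1 (hlin q hq)
      rw [hI, Finset.mem_Icc]
      constructor
      · rw [neg_le]
        apply Int.le_floor.2
        push_cast at h1 ⊢
        linarith
      · exact Int.le_floor.2 h1.2
  have hcard := Finset.card_le_mul_card_image_of_maps_to hmem (k + D) (by
    rintro ⟨ρ, m⟩ hρm
    rcases (P.filter fun q => (cross k D g₁ g₂ q.2.2.1 q.2.2.2,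
      u * (q.2.2.1 : ℤ) + v * q.2.2.2) = (ρ, m)).eq_empty_or_nonempty with h0 | ⟨q₀, hq₀⟩
    · rw [h0]; simp
    have hρ : ρ ≠ 0 := by
      rw [Finset.mem_filter, Prod.mk.injEq] at hq₀
      have := hdvd q₀ hq₀.1
      rw [hq₀.2.1] at this
      exact ne_zero_of_dvd_ne_zero hR this
    apply card_line_le hD g₁ g₂ ρ m u v hρ hu
    · exact hinj.mono (Finset.coe_subset.2 (Finset.filter_subset _ _))
    · intro q hq
      rw [Finset.mem_filter, Prod.mk.injEq] at hq
      have h1 := (hsol q hq.1).mul_cross (hab q hq.1)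
      rw [hq.2.1] at h1
      exact ⟨(hsol q hq.1).1, (hsol q hq.1).2.1, h1.1, h1.2, hq.2.2, hq.2.1⟩)
  rw [Finset.card_product] at hcard
  have h1 : (P.card : ℝ) ≤ (k + D) * (S.card * I.card) := by exact_mod_cast hcard
  refine h1.trans ?_
  have h2 : (S.card : ℝ) ≤ 2 * R.natAbs.divisors.card := by exact_mod_cast hScard
  gcongr

theorem card_slab_le_rpow {k D : ℕ} (hD : D + 2 ≤ k) (m : ℕ) (hm : 0 < m) (B : ℝ) (hB : 1 ≤ B)
    (ε : ℝ) (hε : 0 < ε) : ∃ K : ℝ, 1 ≤ K ∧ ∀ (g₁ g₂ : ℕ → ℤ) (R u v : ℤ) (H T : ℝ)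
    (P : Finset (ℕ × ℕ × ℕ × ℕ)), 1 ≤ H → 0 ≤ T → u ≠ 0 → R ≠ 0 → |(R : ℝ)| ≤ B * H ^ m →
    Set.InjOn (fun q : ℕ × ℕ × ℕ × ℕ => q.2.2) P → (∀ q ∈ P, IsSol k q) →
    (∀ q ∈ P, |((u * q.2.2.1 + v * q.2.2.2 : ℤ) : ℝ)| ≤ T) →
    (∀ q ∈ P, (q.1 : ℤ) * binForm D g₁ q.2.2.1 q.2.2.2 =
      q.2.1 * binForm D g₂ q.2.2.1 q.2.2.2) →
    (∀ q ∈ P, cross k D g₁ g₂ q.2.2.1 q.2.2.2 ∣ R) →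
    (P.card : ℝ) ≤ K * H ^ ε * (1 + T) := by
  have hm' : (0 : ℝ) < m := by exact_mod_cast hm
  obtain ⟨C, hC1, hC⟩ := card_divisors_le_rpow (ε / m) (by positivity)
  have hk : (1 : ℝ) ≤ k + D := by exact_mod_cast (by omega : 1 ≤ k + D)
  have hBε : 1 ≤ B ^ (ε / m) := Real.one_le_rpow hB (by positivity)
  refine ⟨4 * ((k + D) * (C * B ^ (ε / m))), ?_, ?_⟩
  · have := one_le_mul_of_one_le_of_one_le hk (one_le_mul_of_one_le_of_one_le hC1 hBε)
    linarith
  intro g₁ g₂ R u v H T P hH hT hu hR hRB hinj hsol hlin hab hdvd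
  have h1 := card_slab_le hD g₁ g₂ R hR u v hu T hT P hinj hsol hlin hab hdvd
  have h2 : (R.natAbs.divisors.card : ℝ) ≤ C * B ^ (ε / m) * H ^ ε := by
    refine (hC _ (by simpa using hR)).trans ?_
    rw [Nat.cast_natAbs, Int.cast_abs, mul_assoc]
    refine mul_le_mul_of_nonneg_left ?_ (by linarith)
    refine (Real.rpow_le_rpow (abs_nonneg _) hRB (by positivity)).trans (le_of_eq ?_)
    rw [Real.mul_rpow (by linarith) (by positivity), ← Real.rpow_natCast, ← Real.rpow_mul
      (by linarith), mul_div_cancel₀ _ hm'.ne']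
  refine h1.trans ?_
  calc ((k : ℝ) + D) * (2 * R.natAbs.divisors.card * (2 * T + 1))
      ≤ (k + D) * (2 * (C * B ^ (ε / m) * H ^ ε) * (2 * (1 + T))) := by
        gcongr
        linarith
    _ = _ := by ring

theorem card_cell_le {k : ℕ} (D : ℕ) : D + 2 ≤ k → ∀ ε : ℝ, 0 < ε → ∃ K : ℝ, 1 ≤ K ∧
    ∀ (g₁ g₂ : ℕ → ℤ) (u v : ℤ) (H T : ℝ)
    (P : Finset (ℕ × ℕ × ℕ × ℕ)), 1 ≤ H → 0 ≤ T → u ≠ 0 →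
    (∀ i ≤ D, |(g₁ i : ℝ)| ≤ H) → (∀ i ≤ D, |(g₂ i : ℝ)| ≤ H) →
    (∃ i ≤ D, g₁ i ≠ 0 ∨ g₂ i ≠ 0) →
    Set.InjOn (fun q : ℕ × ℕ × ℕ × ℕ => q.2.2) P → (∀ q ∈ P, IsSol k q) →
    (∀ q ∈ P, |((u * q.2.2.1 + v * q.2.2.2 : ℤ) : ℝ)| ≤ T) →
    (∀ q ∈ P, (q.1 : ℤ) * binForm D g₁ q.2.2.1 q.2.2.2 =
      q.2.1 * binForm D g₂ q.2.2.1 q.2.2.2) →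
    (P.card : ℝ) ≤ K * H ^ ε * (1 + T) := by
  induction D with
  | zero =>
    intro hD ε hε
    obtain ⟨K, hK1, hK⟩ := card_slab_le_rpow hD 1 one_pos 1 le_rfl ε hε
    refine ⟨K, hK1, ?_⟩
    intro g₁ g₂ u v H T P hH hT hu h₁ h₂ hne hinj hsol hlin hab
    obtain ⟨i, hi, hne⟩ := hne
    obtain rfl : i = 0 := by omega
    have hb : ∀ g x y, binForm 0 g x y = g 0 := by intro g x y; simp [binForm]
    rcases hne with hne | hne
    · refine hK g₁ g₂ (g₁ 0) u v H T P hH hT hu hne (by simpa using h₁ 0 le_rfl)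
        hinj hsol hlin hab fun q hq => ?_
      have := ((hsol q hq).mul_cross (hab q hq)).2
      rw [hb g₁] at this
      exact Dvd.intro _ this
    · refine hK g₁ g₂ (g₂ 0) u v H T P hH hT hu hne (by simpa using h₂ 0 le_rfl)
        hinj hsol hlin hab fun q hq => ?_
      have := ((hsol q hq).mul_cross (hab q hq)).1
      rw [hb g₂] at this
      exact Dvd.intro _ this
  | succ D ih =>
    intro hD ε hε
    set N : ℕ := D + 1 + (D + 1) with hN
    have hN0 : (0 : ℝ) < N := by exact_mod_cast (by omega : 0 < N)
    have hN1 : (1 : ℝ) ≤ N := by exact_mod_cast (by omega : 1 ≤ N)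
    obtain ⟨K₁, hK₁1, hK₁⟩ := card_slab_le_rpow hD N (by omega) (N.factorial)
      (by exact_mod_cast Nat.one_le_iff_ne_zero.2 (Nat.factorial_ne_zero _)) ε hε
    obtain ⟨K₂, hK₂1, hK₂⟩ := ih (by omega) (ε / N) (by positivity)
    refine ⟨K₁ + (D + 1 : ℕ) + K₂ * (N : ℝ) ^ ε, ?_, ?_⟩
    · have : (0 : ℝ) ≤ (D + 1 : ℕ) + K₂ * (N : ℝ) ^ ε := by positivity
      linarith
    intro g₁ g₂ u v H T P hH hT hu h₁ h₂ hne hinj hsol hlin hab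
    have hHε : 1 ≤ H ^ ε := Real.one_le_rpow hH hε.le
    have hHT : 1 ≤ H ^ ε * (1 + T) := one_le_mul_of_one_le_of_one_le hHε (by linarith)
    have hpos : 0 ≤ K₂ * (N : ℝ) ^ ε := by positivity
    by_cases hdet : (sylv (D + 1) g₁ g₂).det = 0
    · obtain ⟨p, r, hpr, hp, hr, hrel⟩ :=
        exists_syzygy_of_det_sylv_eq_zero D g₁ g₂ H hH h₁ h₂ hdet
      set P₀ := P.filter fun q => cross k (D + 1) g₁ g₂ q.2.2.1 q.2.2.2 = 0 with hP₀
      set P₁ := P.filter fun q => ¬ cross k (D + 1) g₁ g₂ q.2.2.1 q.2.2.2 = 0 with hP₁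
      have hcard : P.card = P₀.card + P₁.card := (Finset.card_filter_add_card_filter_not _).symm
      have hs₀ : P₀ ⊆ P := Finset.filter_subset _ _
      have hs₁ : P₁ ⊆ P := Finset.filter_subset _ _
      have hc₀ : P₀.card ≤ D + 1 := by
        obtain ⟨i, hi, hne⟩ := hne
        have hz : ∀ q ∈ P₀, binForm (D + 1) g₁ q.2.2.1 q.2.2.2 = 0 ∧
            binForm (D + 1) g₂ q.2.2.1 q.2.2.2 = 0 := by
          intro q hq
          rw [hP₀, Finset.mem_filter] at hq
          have := (hsol q hq.1).mul_cross (hab q hq.1)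
          rw [hq.2, zero_mul, zero_mul] at this
          exact ⟨this.2.symm, this.1.symm⟩
        rcases hne with hne | hne
        · exact card_zeros_le (k := k) (by omega) g₁ ⟨i, hi, hne⟩ P₀ (hinj.mono hs₀)
            (fun q hq => hsol q (hs₀ hq)) fun q hq => (hz q hq).1
        · exact card_zeros_le (k := k) (by omega) g₂ ⟨i, hi, hne⟩ P₀ (hinj.mono hs₀)
            (fun q hq => hsol q (hs₀ hq)) fun q hq => (hz q hq).2
      have hneg : ∀ x y, binForm D (fun i => -p i) x y = -binForm D p x y := by
        intro x y
        simp [binForm]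
      have hc₁ : (P₁.card : ℝ) ≤ K₂ * ((N * H) ^ N) ^ (ε / N) * (1 + T) := by
        refine hK₂ r (fun i => -p i) u v ((N * H) ^ N) T P₁
          (one_le_pow₀ (one_le_mul_of_one_le_of_one_le hN1 hH)) hT hu hr
          (fun i hi => by simp only [Int.cast_neg, abs_neg]; exact hp i hi) ?_ (hinj.mono hs₁)
          (fun q hq => hsol q (hs₁ hq)) (fun q hq => hlin q (hs₁ hq)) fun q hq => ?_
        · obtain ⟨i, hi, h⟩ := hpr
          exact ⟨i, hi, by rcases h with h | h <;> simp [h]⟩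
        · rw [hP₁, Finset.mem_filter] at hq
          have h3 := (hsol q hq.1).mul_cross (hab q hq.1)
          have h4 := hrel q.2.2.1 q.2.2.2
          rw [← h3.1, ← h3.2] at h4
          rw [hneg]
          apply mul_left_cancel₀ hq.2
          linear_combination h4
      have h5 : (((N : ℝ) * H) ^ N) ^ (ε / N) = (N : ℝ) ^ ε * H ^ ε := by
        rw [← Real.rpow_natCast, ← Real.rpow_mul (by positivity), mul_div_cancel₀ _ hN0.ne',
          Real.mul_rpow (by linarith) (by linarith)]
      rw [h5] at hc₁
      have hc₀' : (P₀.card : ℝ) ≤ (D + 1 : ℕ) := by exact_mod_cast hc₀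
      have h6 : ((D + 1 : ℕ) : ℝ) ≤ (D + 1 : ℕ) * (H ^ ε * (1 + T)) :=
        le_mul_of_one_le_right (by positivity) hHT
      have h7 : 0 ≤ K₁ * (H ^ ε * (1 + T)) := by positivity
      rw [hcard]
      push_cast at *
      linarith
    · have h3 := hK₁ g₁ g₂ _ u v H T P hH hT hu hdet
        (abs_det_sylv_le (D + 1) g₁ g₂ H (by linarith) h₁ h₂) hinj hsol hlin hab
        fun q hq => by
          have h4 := (hsol q hq).mul_cross (hab q hq)
          exact dvd_det_sylv (D + 1) (by omega) g₁ g₂ _ _ _ ((hsol q hq).isCoprime (by omega))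
            (Dvd.intro _ h4.2) (Dvd.intro _ h4.1)
      refine h3.trans ?_
      gcongr
      have : (0 : ℝ) ≤ (D + 1 : ℕ) := by positivity
      linarith

theorem exists_small_two_block_sum {k D : ℕ} (hD : D < k) :
    ∃ K : ℝ, 1 ≤ K ∧ ∀ s M l : ℝ, 0 < s → 1 ≤ M → 0 < l → (k + D : ℝ) ≤ M →
      K * s ^ (D + k) < l ^ 2 * M ^ (2 * D + 1) →
      ∃ c d : ℕ → ℤ, (∃ i ≤ D, c i ≠ 0 ∨ d i ≠ 0) ∧
        (∀ i ≤ D, |(c i : ℝ)| * s ^ i ≤ K * l * M ^ (2 * D + 1)) ∧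
        (∀ i ≤ D, |(d i : ℝ)| * s ^ (i + k) ≤ K * l * M ^ (2 * D + 1)) ∧
        ∀ θ : ℝ, |θ| ≤ 1 / M →
          |∑ i ∈ Finset.range (D + 1), (c i : ℝ) * (s * Real.exp θ) ^ i +
            ∑ i ∈ Finset.range (D + 1), (d i : ℝ) * (s * Real.exp θ) ^ (i + k)| ≤ K * l := by
  set e : Fin (D + 1 + (D + 1)) → ℕ := Fin.append (fun i => (i : ℕ)) (fun i => (i : ℕ) + k) with he
  have heinj : Function.Injective e := by
    intro i j
    refine Fin.addCases (fun i => ?_) (fun i => ?_) i <;>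
    refine Fin.addCases (fun j => ?_) (fun j => ?_) j <;>
    simp only [he, Fin.append_left, Fin.append_right] <;>
    intro h
    · rw [Fin.ext h]
    · omega
    · omega
    · rw [Fin.ext (Nat.add_right_cancel h)]
  obtain ⟨K, hK1, hK⟩ := exists_small_exponential_sum (by omega) e heinj
  refine ⟨K, hK1, ?_⟩
  intro s M l hs hM hl hkM hcond
  have hsum1 : ∑ i ∈ Finset.range (D + 1 + (D + 1)), i = (2 * D + 1) * (D + 1) := by
    have := Finset.sum_range_id_mul_two (D + 1 + (D + 1))
    rw [show D + 1 + (D + 1) - 1 = 2 * D + 1 by omega] at this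
    nlinarith
  have hprod1 : ∏ m : Fin (D + 1 + (D + 1)), (l * M ^ (m : ℕ)) =
      (l ^ 2 * M ^ (2 * D + 1)) ^ (D + 1) := by
    rw [Fin.prod_univ_eq_prod_range (fun m => l * M ^ m), Finset.prod_mul_distrib,
      Finset.prod_pow_eq_pow_sum, hsum1, Finset.prod_const, Finset.card_range, mul_pow, ← pow_mul,
      ← pow_mul]
    congr 2
    ring
  have hsum2 : ∑ i ∈ Finset.range (D + 1), i + ∑ i ∈ Finset.range (D + 1), (i + k) =
      (D + k) * (D + 1) := by
    rw [Finset.sum_add_distrib, Finset.sum_const, Finset.card_range, smul_eq_mul]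
    have := Finset.sum_range_id_mul_two (D + 1)
    rw [Nat.add_sub_cancel] at this
    nlinarith
  have hprod2 : ∏ j, s ^ e j = (s ^ (D + k)) ^ (D + 1) := by
    rw [Fin.prod_univ_add]
    simp only [he, Fin.append_left, Fin.append_right]
    rw [Fin.prod_univ_eq_prod_range (fun i => s ^ i),
      Fin.prod_univ_eq_prod_range (fun i => s ^ (i + k)), Finset.prod_pow_eq_pow_sum,
      Finset.prod_pow_eq_pow_sum, ← pow_add, hsum2, pow_mul]
  obtain ⟨t, ht0, htb, hts⟩ := hK s M l hs hM hl (by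
      refine Fin.addCases (fun i => ?_) (fun i => ?_)
      · simp only [he, Fin.append_left]
        have : ((i : ℕ) : ℝ) ≤ k + D := by exact_mod_cast (by omega : (i : ℕ) ≤ k + D)
        linarith
      · simp only [he, Fin.append_right]
        have : (((i : ℕ) + k : ℕ) : ℝ) ≤ k + D := by exact_mod_cast (by omega : (i : ℕ) + k ≤ k + D)
        linarith) (by
      rw [hprod1, hprod2]
      calc K * (s ^ (D + k)) ^ (D + 1) ≤ K ^ (D + 1) * (s ^ (D + k)) ^ (D + 1) := by
            gcongr
            exact le_self_pow₀ hK1 (by omega)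
        _ = (K * s ^ (D + k)) ^ (D + 1) := (mul_pow _ _ _).symm
        _ < _ := pow_lt_pow_left₀ hcond (by positivity) (by omega))
  set c : ℕ → ℤ := fun i => if h : i < D + 1 then t (Fin.castAdd (D + 1) ⟨i, h⟩) else 0 with hc
  set d : ℕ → ℤ := fun i => if h : i < D + 1 then t (Fin.natAdd (D + 1) ⟨i, h⟩) else 0 with hd
  have hci : ∀ i : Fin (D + 1), c i = t (Fin.castAdd (D + 1) i) := fun i => dif_pos i.isLt
  have hdi : ∀ i : Fin (D + 1), d i = t (Fin.natAdd (D + 1) i) := fun i => dif_pos i.isLt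
  refine ⟨c, d, ?_, ?_, ?_, ?_⟩
  · by_contra! hcon
    apply ht0
    ext j
    refine Fin.addCases (fun i => ?_) (fun i => ?_) j
    · rw [← hci]; exact (hcon i (by omega)).1
    · rw [← hdi]; exact (hcon i (by omega)).2
  · intro i hi
    have := htb (Fin.castAdd (D + 1) ⟨i, by omega⟩)
    rw [← hci] at this
    simp only [he, Fin.append_left] at this
    rwa [show D + 1 + (D + 1) - 1 = 2 * D + 1 by omega] at this
  · intro i hi
    have := htb (Fin.natAdd (D + 1) ⟨i, by omega⟩)
    rw [← hdi] at this
    simp only [he, Fin.append_right] at this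
    rwa [show D + 1 + (D + 1) - 1 = 2 * D + 1 by omega] at this
  · intro θ hθ
    have := hts θ hθ
    rw [Fin.sum_univ_add] at this
    simp only [he, Fin.append_left, Fin.append_right, ← hci, ← hdi] at this
    rwa [Fin.sum_univ_eq_sum_range (fun i => (c i : ℝ) * (s * Real.exp θ) ^ i),
      Fin.sum_univ_eq_sum_range (fun i => (d i : ℝ) * (s * Real.exp θ) ^ (i + k))] at this

theorem binForm_cast_eq (D : ℕ) (g : ℕ → ℤ) (x y : ℤ) (σ : ℝ) (h : (x : ℝ) = σ * y) :
    (binForm D g x y : ℝ) = (y : ℝ) ^ D * ∑ i ∈ Finset.range (D + 1), (g i : ℝ) * σ ^ i := by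
  rw [binForm, Finset.mul_sum]
  push_cast
  refine Finset.sum_congr rfl fun i hi => ?_
  rw [Finset.mem_range] at hi
  rw [h, mul_pow]
  conv_rhs => rw [show D = (D - i) + i by omega, pow_add]
  ring

theorem mul_binForm_eq_of_small {k D : ℕ} {c d : ℕ → ℤ} {A s M θ X Y Z : ℝ} {q : ℕ × ℕ × ℕ × ℕ}
    (hk : k ≠ 0) (hq : IsSol k q) (hs : 0 < s) (hM : 1 ≤ M) (hkM : (k + D : ℝ) ≤ M) (hX : 0 < X)
    (hxX : X < q.2.2.1) (hyY : (q.2.2.2 : ℝ) ≤ 2 * Y) (hZ : 1 ≤ Z)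
    (hbZ : (q.2.1 : ℝ) * (q.2.2.2 : ℝ) ^ k ≤ 2 * Z) (hA : 0 ≤ A)
    (hσ : (q.2.2.1 : ℝ) = s * Real.exp θ * q.2.2.2) (hθ : |θ| ≤ 1 / M)
    (hd : ∀ i ≤ D, |(d i : ℝ)| * s ^ (i + k) ≤ A * M ^ (2 * D + 1))
    (hcd : |∑ i ∈ Finset.range (D + 1), (c i : ℝ) * (s * Real.exp θ) ^ i +
            ∑ i ∈ Finset.range (D + 1), (d i : ℝ) * (s * Real.exp θ) ^ (i + k)| ≤ A)
    (hsmall : (2 * Y) ^ D * (A * (3 * Z + 3 * (D + 1) * M ^ (2 * D + 1))) ≤ X ^ k) :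
    (q.1 : ℤ) * binForm D c q.2.2.1 q.2.2.2 =
      q.2.1 * binForm D (fun i => -d i) q.2.2.1 q.2.2.2 := by
  set σ := s * Real.exp θ with hσdef
  have hneg : binForm D (fun i => -d i) q.2.2.1 q.2.2.2 = -binForm D d q.2.2.1 q.2.2.2 := by
    simp [binForm]
  set V : ℤ := q.1 * binForm D c q.2.2.1 q.2.2.2 + q.2.1 * binForm D d q.2.2.1 q.2.2.2 with hV
  suffices hV0 : V = 0 by rw [hneg]; linarith
  have hx0 : (0 : ℝ) < q.2.2.1 := by linarith
  have hy0 : (0 : ℝ) < q.2.2.2 := by exact_mod_cast hq.2.2.2.1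
  set x := (q.2.2.1 : ℝ) with hxdef
  set y := (q.2.2.2 : ℝ) with hydef
  set F := ∑ i ∈ Finset.range (D + 1), (c i : ℝ) * σ ^ i with hF
  set G := ∑ i ∈ Finset.range (D + 1), (d i : ℝ) * σ ^ (i + k) with hG
  set E := ∑ i ∈ Finset.range (D + 1), (d i : ℝ) * σ ^ i with hE
  have hGE : G = E * σ ^ k := by
    rw [hG, hE, Finset.sum_mul]
    exact Finset.sum_congr rfl fun i _ => by rw [pow_add]; ring
  have heq : (q.1 : ℝ) * x ^ k - q.2.1 * y ^ k = 1 := by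
    rw [hxdef, hydef]; exact_mod_cast hq.2.2.2.2
  have hVr : (V : ℝ) = q.1 * (y ^ D * F) + q.2.1 * (y ^ D * E) := by
    rw [hV]
    push_cast
    rw [binForm_cast_eq D c _ _ σ (by simpa using hσ), binForm_cast_eq D d _ _ σ (by simpa using hσ)]
    simp [hF, hE, hydef]
  have hkey : x ^ k * (V : ℝ) = y ^ D * (q.1 * x ^ k * (F + G) - G) := by
    rw [hVr, hGE]
    have h1 : x ^ k = σ ^ k * y ^ k := by rw [hσ, mul_pow]
    have h2 : (q.2.1 : ℝ) * x ^ k = (q.1 * x ^ k - 1) * σ ^ k := by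
      rw [← heq]
      linear_combination (q.2.1 : ℝ) * h1
    linear_combination y ^ D * E * h2
  have hGb : |G| ≤ A * (3 * (D + 1) * M ^ (2 * D + 1)) := by
    have h1 : ∀ i ∈ Finset.range (D + 1),
        |(d i : ℝ) * σ ^ (i + k)| ≤ A * M ^ (2 * D + 1) * 3 := by
      intro i hi
      rw [Finset.mem_range] at hi
      rw [abs_mul, abs_of_pos (show 0 < σ ^ (i + k) by positivity), hσdef, mul_pow, ← mul_assoc]
      refine mul_le_mul (hd i (by omega)) ?_ (by positivity) (by positivity)
      rw [← Real.exp_nat_mul]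
      have h2 : ((i + k : ℕ) : ℝ) * θ ≤ 1 := by
        have h3 : ((i + k : ℕ) : ℝ) ≤ M := by
          refine le_trans ?_ hkM
          exact_mod_cast (by omega : i + k ≤ k + D)
        calc ((i + k : ℕ) : ℝ) * θ ≤ ((i + k : ℕ) : ℝ) * (1 / M) :=
              mul_le_mul_of_nonneg_left ((le_abs_self _).trans hθ) (Nat.cast_nonneg _)
          _ ≤ M * (1 / M) := mul_le_mul_of_nonneg_right h3 (by positivity)
          _ = 1 := by field_simp
      exact (Real.exp_le_exp.2 h2).trans (by linarith [Real.exp_one_lt_d9])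
    calc |G| ≤ ∑ i ∈ Finset.range (D + 1), |(d i : ℝ) * σ ^ (i + k)| :=
          Finset.abs_sum_le_sum_abs _ _
      _ ≤ ∑ i ∈ Finset.range (D + 1), A * M ^ (2 * D + 1) * 3 := Finset.sum_le_sum h1
      _ = _ := by rw [Finset.sum_const, Finset.card_range, nsmul_eq_mul]; push_cast; ring
  have hax : (q.1 : ℝ) * x ^ k ≤ 3 * Z := by linarith
  have hbound : |x ^ k * (V : ℝ)| ≤ X ^ k := by
    refine le_trans ?_ hsmall
    rw [hkey, abs_mul, abs_of_pos (pow_pos hy0 D)]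
    refine mul_le_mul (pow_le_pow_left₀ hy0.le hyY D) ?_ (abs_nonneg _) (by
      have := hy0.le.trans hyY
      positivity)
    refine (abs_sub _ _).trans ?_
    have h1 : |(q.1 : ℝ) * x ^ k * (F + G)| ≤ 3 * Z * A := by
      rw [abs_mul, abs_of_nonneg (show 0 ≤ (q.1 : ℝ) * x ^ k by positivity)]
      exact mul_le_mul hax hcd (abs_nonneg _) (by linarith)
    linarith
  have hlt : |(V : ℝ)| < 1 := by
    rw [abs_mul, abs_of_pos (pow_pos hx0 k)] at hbound
    have h1 : X ^ k < x ^ k := pow_lt_pow_left₀ hxX hX.le hk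
    by_contra! h2
    have := le_mul_of_one_le_right (pow_pos hx0 k).le h2
    linarith
  exact Int.abs_lt_one_iff.1 (by exact_mod_cast hlt)

theorem exists_small_linear_form (s U : ℝ) (hs : 0 < s) (hU : 1 ≤ U) :
    ∃ u v : ℤ, u ≠ 0 ∧ ∀ x y θ : ℝ, 0 ≤ y → |θ| ≤ 1 → x = s * Real.exp θ * y →
      |u * x + v * y| ≤ y * (1 / U + 2 * U * s * |θ|) := by
  obtain ⟨j, m, hm0, hmn, hjm⟩ :=
    Real.exists_int_int_abs_mul_sub_le s (Nat.floor_pos.2 hU)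
  refine ⟨m, -j, hm0.ne', ?_⟩
  intro x y θ hy hθ hx
  have h1 : |(m : ℝ) * s - j| ≤ 1 / U :=
    hjm.trans (one_div_le_one_div_of_le (by linarith) (Nat.lt_floor_add_one U).le)
  have hm0' : (0 : ℝ) < m := by exact_mod_cast hm0
  have h2 : (m : ℝ) ≤ U := by
    refine le_trans ?_ (Nat.floor_le (show 0 ≤ U by linarith))
    exact_mod_cast hmn
  have h3 : |(m : ℝ) * s * (Real.exp θ - 1)| ≤ 2 * U * s * |θ| := by
    rw [abs_mul, abs_of_pos (mul_pos hm0' hs)]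
    have := Real.abs_exp_sub_one_le hθ
    calc (m : ℝ) * s * |Real.exp θ - 1| ≤ U * s * (2 * |θ|) := by gcongr
      _ = _ := by ring
  have h4 : (m : ℝ) * x + ((-j : ℤ) : ℝ) * y =
      y * ((m * s - j) + m * s * (Real.exp θ - 1)) := by
    rw [hx]; push_cast; ring
  rw [h4, abs_mul, abs_of_nonneg hy]
  exact mul_le_mul_of_nonneg_left ((abs_add_le _ _).trans (add_le_add h1 h3)) hy

theorem card_arc_le {k D : ℕ} (hD : D + 2 ≤ k) (B : ℝ) (hB : 1 ≤ B) (ε : ℝ) (hε : 0 < ε) :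
    ∃ K L : ℝ, 1 ≤ K ∧ 1 ≤ L ∧ ∀ (X Y Z M s : ℝ) (P : Finset (ℕ × ℕ × ℕ × ℕ)),
      1 ≤ X → 1 ≤ Y → 1 ≤ Z → 1 ≤ M → 0 < s → (k + D : ℝ) ≤ M → X ≤ Y * M →
      X ^ k ≤ B * Z → Y ^ k ≤ B * Z → M ^ (2 * D + 1) ≤ Z →
      L * Z ^ 2 ≤ (X * Y) ^ (k - D) * M ^ (2 * D + 1) →
      Set.InjOn (fun q : ℕ × ℕ × ℕ × ℕ => q.2.2) P →
      (∀ q ∈ P, IsSol k q ∧ X < q.2.2.1 ∧ (q.2.2.1 : ℝ) ≤ 2 * X ∧ Y < q.2.2.2 ∧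
        (q.2.2.2 : ℝ) ≤ 2 * Y ∧ (q.2.1 : ℝ) * (q.2.2.2 : ℝ) ^ k ≤ 2 * Z ∧
        ∃ θ : ℝ, |θ| ≤ 1 / M ∧ (q.2.2.1 : ℝ) = s * Real.exp θ * q.2.2.2) →
      (P.card : ℝ) ≤ K * Z ^ ε * (1 + √(X * Y / M)) := by
  obtain ⟨K₀, hK₀1, hK₀⟩ := exists_small_two_block_sum (show D < k by omega)
  obtain ⟨K₁, hK₁1, hK₁⟩ := card_cell_le D hD (ε / 3) (by positivity)
  set κ : ℝ := 1 / (2 ^ D * K₀ * (3 * (D + 2))) with hκ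
  have hden : (1 : ℝ) ≤ 2 ^ D * K₀ * (3 * (D + 2)) :=
    one_le_mul_of_one_le_of_one_le (one_le_mul_of_one_le_of_one_le (one_le_pow₀ (by norm_num)) hK₀1)
      (by have : (0 : ℝ) ≤ D := Nat.cast_nonneg D
          linarith)
  have hκ0 : 0 < κ := by positivity
  have hκ1 : κ ≤ 1 := by rw [hκ]; exact (div_le_one (by linarith)).2 hden
  have hκeq : 2 ^ D * K₀ * κ * (3 * (D + 2)) = 1 := by
    rw [hκ]; field_simp
  set J : ℝ := K₀ * 36 ^ k * B ^ 3 with hJ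
  have hJ1 : 1 ≤ J := one_le_mul_of_one_le_of_one_le
    (one_le_mul_of_one_le_of_one_le hK₀1 (one_le_pow₀ (by norm_num))) (one_le_pow₀ hB)
  refine ⟨K₁ * J ^ (ε / 3) * 26, 1 + K₀ * 6 ^ (D + k) / κ ^ 2, ?_, ?_, ?_⟩
  · exact one_le_mul_of_one_le_of_one_le (one_le_mul_of_one_le_of_one_le hK₁1
      (Real.one_le_rpow hJ1 (by positivity))) (by norm_num)
  · have : 0 ≤ K₀ * 6 ^ (D + k) / κ ^ 2 := by positivity
    linarith
  intro X Y Z M s P hX hY hZ hM hs hkM hXYM hXB hYB hMZ hL hinj hP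
  rcases P.eq_empty_or_nonempty with rfl | ⟨q₀, hq₀⟩
  · rw [Finset.card_empty, Nat.cast_zero]; positivity
  have hM1 : 1 / M ≤ 1 := (div_le_one (by linarith)).2 hM
  have hs6 : s * Y ≤ 6 * X ∧ X ≤ 6 * (s * Y) := by
    obtain ⟨-, h1, h2, h3, h4, -, θ, hθ, h5⟩ := hP q₀ hq₀
    have hθ' := abs_le.1 (hθ.trans hM1)
    have he1 : Real.exp θ ≤ 3 :=
      (Real.exp_le_exp.2 hθ'.2).trans (by linarith [Real.exp_one_lt_d9])
    have he2 : Real.exp (-θ) ≤ 3 :=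
      (Real.exp_le_exp.2 (by linarith : -θ ≤ 1)).trans (by linarith [Real.exp_one_lt_d9])
    have he3 : Real.exp θ * Real.exp (-θ) = 1 := by rw [← Real.exp_add]; simp
    constructor
    · calc s * Y ≤ s * q₀.2.2.2 := by gcongr
        _ = (q₀.2.2.1 : ℝ) * Real.exp (-θ) := by
          rw [h5]; linear_combination -(s * (q₀.2.2.2 : ℝ)) * he3
        _ ≤ (2 * X) * 3 := by gcongr
        _ = 6 * X := by ring
    · calc X ≤ s * Real.exp θ * q₀.2.2.2 := by rw [← h5]; exact h1.le
        _ ≤ s * 3 * (2 * Y) := by gcongr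
        _ = _ := by ring
  set l : ℝ := κ * X ^ k / (Y ^ D * Z) with hl
  have hl0 : 0 < l := by positivity
  have hlB : l ≤ B := by
    rw [hl, div_le_iff₀ (by positivity)]
    have h1 : (1 : ℝ) ≤ Y ^ D := one_le_pow₀ hY
    calc κ * X ^ k ≤ 1 * (B * Z) := by gcongr
      _ ≤ B * (Y ^ D * Z) := by
        rw [one_mul]
        gcongr
        exact le_mul_of_one_le_left (by linarith) h1
  have hcond : K₀ * s ^ (D + k) < l ^ 2 * M ^ (2 * D + 1) := by
    have h1 : K₀ * 6 ^ (D + k) * Z ^ 2 < κ ^ 2 * ((X * Y) ^ (k - D) * M ^ (2 * D + 1)) := by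
      have h2 : K₀ * 6 ^ (D + k) * Z ^ 2 <
          κ ^ 2 * ((1 + K₀ * 6 ^ (D + k) / κ ^ 2) * Z ^ 2) := by
        have h3 : κ ^ 2 * ((1 + K₀ * 6 ^ (D + k) / κ ^ 2) * Z ^ 2) =
            κ ^ 2 * Z ^ 2 + K₀ * 6 ^ (D + k) * Z ^ 2 := by
          field_simp
        rw [h3]
        have : 0 < κ ^ 2 * Z ^ 2 := by positivity
        linarith
      exact h2.trans_le (mul_le_mul_of_nonneg_left hL (by positivity))
    have h4 : (Y ^ D * Z) ^ 2 * Y ^ (k - D) = Y ^ (D + k) * Z ^ 2 := by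
      rw [mul_pow, ← pow_mul, show D + k = D * 2 + (k - D) by omega, pow_add]; ring
    have h5 : X ^ k * X ^ k = X ^ (D + k) * X ^ (k - D) := by
      rw [← pow_add, ← pow_add]; congr 1; omega
    rw [hl, div_pow, div_mul_eq_mul_div, lt_div_iff₀ (by positivity)]
    have hYp : 0 < Y ^ (k - D) := by positivity
    refine lt_of_mul_lt_mul_right ?_ hYp.le
    calc K₀ * s ^ (D + k) * (Y ^ D * Z) ^ 2 * Y ^ (k - D)
        = K₀ * (s * Y) ^ (D + k) * Z ^ 2 := by rw [mul_assoc, h4, mul_pow]; ring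
      _ ≤ K₀ * (6 * X) ^ (D + k) * Z ^ 2 := by gcongr K₀ * ?_ ^ (D + k) * Z ^ 2; exact hs6.1
      _ = X ^ (D + k) * (K₀ * 6 ^ (D + k) * Z ^ 2) := by rw [mul_pow]; ring
      _ < X ^ (D + k) * (κ ^ 2 * ((X * Y) ^ (k - D) * M ^ (2 * D + 1))) := by gcongr
      _ = _ := by
        rw [mul_pow X Y, mul_pow κ]
        linear_combination -(κ ^ 2 * Y ^ (k - D) * M ^ (2 * D + 1)) * h5
  obtain ⟨c, d, hcd0, hcb, hdb, hcd⟩ := hK₀ s M l hs hM hl0 hkM hcond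
  have hsmall : (2 * Y) ^ D * (K₀ * l * (3 * Z + 3 * (D + 1) * M ^ (2 * D + 1))) ≤ X ^ k := by
    calc (2 * Y) ^ D * (K₀ * l * (3 * Z + 3 * (D + 1) * M ^ (2 * D + 1)))
        ≤ (2 * Y) ^ D * (K₀ * l * (3 * Z + 3 * (D + 1) * Z)) := by gcongr
      _ = (2 ^ D * K₀ * κ * (3 * (D + 2))) * X ^ k := by
        rw [hl, mul_pow]; field_simp; ring
      _ = X ^ k := by rw [hκeq, one_mul]
  set U : ℝ := √(Y * M / X) with hU
  have hU1 : 1 ≤ U := Real.one_le_sqrt.2 ((one_le_div (by linarith)).2 hXYM)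
  have hUsq : U ^ 2 = Y * M / X := Real.sq_sqrt (by positivity)
  obtain ⟨u, v, hu, huv⟩ := exists_small_linear_form s U hs hU1
  have hT : 26 * Y / U = 26 * √(X * Y / M) := by
    have h1 : √(X * Y / M) * U = Y := by
      rw [hU, ← Real.sqrt_mul (by positivity),
        show X * Y / M * (Y * M / X) = Y ^ 2 by field_simp, Real.sqrt_sq (by linarith)]
    rw [div_eq_iff (by linarith), mul_assoc, h1]
  have hs1 : 1 / s ≤ 6 * Y := by
    rw [div_le_iff₀ hs]
    linarith [hs6.2]
  have hsc : ∀ i ≤ 2 * k, ∀ z : ℤ, |(z : ℝ)| * s ^ i ≤ K₀ * l * M ^ (2 * D + 1) →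
      |(z : ℝ)| ≤ J * Z ^ 3 := by
    intro i hi z hz
    have h1 : (1 / s) ^ i ≤ (36 ^ k : ℝ) * (B * Z) ^ 2 := by
      calc (1 / s) ^ i ≤ (6 * Y) ^ i := by gcongr
        _ ≤ (6 * Y) ^ (2 * k) := pow_le_pow_right₀ (by linarith) hi
        _ = (36 ^ k : ℝ) * (Y ^ k) ^ 2 := by
          rw [mul_pow, pow_mul, ← pow_mul Y, mul_comm k 2]; norm_num
        _ ≤ _ := by gcongr
    calc |(z : ℝ)| = |(z : ℝ)| * s ^ i * (1 / s) ^ i := by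
          rw [mul_assoc, ← mul_pow, mul_one_div_cancel hs.ne', one_pow, mul_one]
      _ ≤ (K₀ * B * Z) * (36 ^ k * (B * Z) ^ 2) := by
          refine mul_le_mul (hz.trans ?_) h1 (by positivity) (by positivity)
          gcongr
      _ = J * Z ^ 3 := by rw [hJ]; ring
  have hmain := hK₁ c (fun i => -d i) u v (J * Z ^ 3) (26 * √(X * Y / M)) P
    (one_le_mul_of_one_le_of_one_le hJ1 (one_le_pow₀ hZ)) (by positivity) hu
    (fun i hi => hsc i (by omega) _ (hcb i hi))
    (fun i hi => by
      simp only [Int.cast_neg, abs_neg]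
      exact hsc (i + k) (by omega) _ (hdb i hi))
    (by
      obtain ⟨i, hi, h⟩ := hcd0
      exact ⟨i, hi, by rcases h with h | h <;> simp [h]⟩)
    hinj (fun q hq => (hP q hq).1)
    (fun q hq => by
      obtain ⟨-, h1, h2, h3, h4, -, θ, hθ, h5⟩ := hP q hq
      have h6 := huv q.2.2.1 q.2.2.2 θ (by positivity) (hθ.trans hM1) h5
      push_cast
      refine h6.trans ?_
      rw [← hT]
      calc (q.2.2.2 : ℝ) * (1 / U + 2 * U * s * |θ|)
          ≤ 2 * Y * (1 / U + 2 * U * s * (1 / M)) := by gcongr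
        _ = 2 * Y / U + 4 * U * (s * Y) / M := by ring
        _ ≤ 2 * Y / U + 4 * U * (6 * X) / M := by gcongr 2 * Y / U + 4 * U * ?_ / M; exact hs6.1
        _ = 26 * Y / U := by
          have h7 : U * X / M = Y / U := by
            rw [div_eq_div_iff (by positivity) (by positivity)]
            have : U ^ 2 * X = Y * M := by rw [hUsq]; field_simp
            linarith
          linear_combination 24 * h7)
    (fun q hq => by
      obtain ⟨hsol, h1, h2, h3, h4, h5, θ, hθ, h6⟩ := hP q hq
      exact mul_binForm_eq_of_small (by omega) hsol hs hM hkM (by linarith) h1 h4 hZ h5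
        (by positivity) h6 hθ hdb (hcd θ hθ) hsmall)
  refine hmain.trans ?_
  have h8 : (J * Z ^ 3) ^ (ε / 3) = J ^ (ε / 3) * Z ^ ε := by
    rw [Real.mul_rpow (by linarith) (by positivity), ← Real.rpow_natCast Z,
      ← Real.rpow_mul (by linarith)]
    congr 2
    push_cast
    ring
  rw [h8]
  have h9 : 0 ≤ √(X * Y / M) := Real.sqrt_nonneg _
  calc K₁ * (J ^ (ε / 3) * Z ^ ε) * (1 + 26 * √(X * Y / M))
      ≤ K₁ * (J ^ (ε / 3) * Z ^ ε) * (26 * (1 + √(X * Y / M))) := by gcongr; linarith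
    _ = _ := by ring

theorem exists_arc_parameter {k : ℕ} (hk : 2 ≤ k) (c₁ L : ℝ) (hc₁ : 1 ≤ c₁) (hL : 1 ≤ L) :
    ∃ Q : ℝ, 1 ≤ Q ∧ ∀ X Y z : ℝ, 1 ≤ X → 1 ≤ Y → Q ≤ z → X ≤ c₁ * z ^ 9 → Y ≤ c₁ * z ^ 9 →
      z ^ 14 ≤ X * Y → ∃ M : ℝ, 1 ≤ M ∧ (k + (k / 3 : ℕ) : ℝ) ≤ M ∧ X ≤ Y * M ∧
        M ^ (2 * (k / 3) + 1) ≤ z ^ (9 * k) ∧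
        L * (z ^ (9 * k)) ^ 2 ≤ (X * Y) ^ (k - k / 3) * M ^ (2 * (k / 3) + 1) ∧
        M * (1 + √(X * Y / M)) ≤ Q * z ^ 14 := by
  set D := k / 3 with hD
  set n := 2 * D + 1 with hn
  have hn0 : n ≠ 0 := by omega
  have hk0 : (1 : ℝ) ≤ 2 * k := by exact_mod_cast (by omega : 1 ≤ 2 * k)
  set C₁ : ℝ := L * c₁ ^ (2 * k) * (2 * k) ^ n with hC₁
  have h2k : (1 : ℝ) ≤ (2 * k) ^ n := one_le_pow₀ hk0
  have hc2k : 1 ≤ c₁ ^ (2 * k) := one_le_pow₀ hc₁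
  have hLC : L ≤ C₁ := by
    rw [hC₁, mul_assoc]
    exact le_mul_of_one_le_right (by linarith) (one_le_mul_of_one_le_of_one_le hc2k h2k)
  have hC₁1 : 1 ≤ C₁ := hL.trans hLC
  have hcC : c₁ ^ (2 * k) * (2 * k) ^ n ≤ C₁ := by
    rw [hC₁, mul_assoc]
    exact le_mul_of_one_le_left (by positivity) hL
  have hcC' : c₁ ^ (2 * k) ≤ C₁ := le_trans (le_mul_of_one_le_right (by linarith) h2k) hcC
  set Q : ℝ := C₁ * c₁ ^ 2 with hQ
  have hCQ : C₁ ≤ Q := le_mul_of_one_le_right (by linarith) (one_le_pow₀ hc₁)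
  have hQ1 : 1 ≤ Q := hC₁1.trans hCQ
  refine ⟨2 * Q, by linarith, ?_⟩
  intro X Y z hX hY hz hXz hYz hW
  have hz1 : 1 ≤ z := by linarith
  set W := X * Y with hWdef
  have hW1 : 1 ≤ W := one_le_mul_of_one_le_of_one_le hX hY
  have hW0 : 0 < W := by linarith
  have hWz : W ≤ c₁ ^ 2 * z ^ 18 := by
    calc W ≤ (c₁ * z ^ 9) * (c₁ * z ^ 9) := by rw [hWdef]; gcongr
      _ = _ := by ring
  set V : ℝ := C₁ * (z ^ (9 * k)) ^ 2 / W ^ (k - D) with hV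
  have hV0 : 0 < V := by positivity
  have hVW : V * W ^ (k - D) = C₁ * z ^ (18 * k) := by
    rw [hV, div_mul_cancel₀ _ (by positivity), ← pow_mul]
    congr 2; ring
  set M : ℝ := V ^ (1 / (n : ℝ)) with hM
  have hM0 : 0 < M := Real.rpow_pos_of_pos hV0 _
  have hMV : M ^ n = V := by
    rw [hM, one_div]; exact Real.rpow_inv_natCast_pow hV0.le hn0
  have hWk : W ^ (k - D) ≤ W ^ k := pow_le_pow_right₀ hW1 (by omega)
  have hWkz : W ^ k ≤ c₁ ^ (2 * k) * z ^ (18 * k) := by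
    calc W ^ k ≤ (c₁ ^ 2 * z ^ 18) ^ k := by gcongr
      _ = _ := by rw [mul_pow, ← pow_mul, ← pow_mul]
  have h2kM : 2 * (k : ℝ) ≤ M := by
    refine le_of_pow_le_pow_left₀ hn0 hM0.le ?_
    rw [hMV]
    refine le_of_mul_le_mul_right ?_ (pow_pos hW0 (k - D))
    rw [hVW]
    calc (2 * (k : ℝ)) ^ n * W ^ (k - D) ≤ (2 * (k : ℝ)) ^ n * (c₁ ^ (2 * k) * z ^ (18 * k)) := by
          gcongr; exact hWk.trans hWkz
      _ = (c₁ ^ (2 * k) * (2 * k) ^ n) * z ^ (18 * k) := by ring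
      _ ≤ _ := by gcongr
  have hM1 : 1 ≤ M := by linarith
  have hXYM : X ≤ Y * M := by
    rcases le_total X Y with h | h
    · exact h.trans (le_mul_of_one_le_right (by linarith) hM1)
    · have h1 : 1 ≤ X / Y := (one_le_div (by linarith)).2 h
      rw [mul_comm, ← div_le_iff₀ (by linarith)]
      refine le_of_pow_le_pow_left₀ hn0 hM0.le ?_
      rw [hMV]
      refine le_of_mul_le_mul_right ?_ (pow_pos hW0 (k - D))
      rw [hVW]
      calc (X / Y) ^ n * W ^ (k - D) ≤ (X / Y) ^ k * W ^ k := by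
            gcongr ?_ * ?_
            exact pow_le_pow_right₀ h1 (by omega)
        _ = (X ^ 2) ^ k := by rw [← mul_pow, hWdef]; congr 1; field_simp
        _ ≤ ((c₁ * z ^ 9) ^ 2) ^ k := by gcongr
        _ = c₁ ^ (2 * k) * z ^ (18 * k) := by
          rw [← pow_mul, mul_pow, ← pow_mul]; congr 2; ring
        _ ≤ _ := by gcongr
  have hMZ : M ^ n ≤ z ^ (9 * k) := by
    rw [hMV]
    refine le_of_mul_le_mul_right ?_ (pow_pos hW0 (k - D))
    rw [hVW]
    calc C₁ * z ^ (18 * k) ≤ z * z ^ (18 * k) := by gcongr; linarith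
      _ = z ^ (18 * k + 1) := by ring
      _ ≤ z ^ (9 * k + 14 * (k - D)) := pow_le_pow_right₀ hz1 (by omega)
      _ = z ^ (9 * k) * (z ^ 14) ^ (k - D) := by rw [pow_add, pow_mul z 14]
      _ ≤ _ := by gcongr
  have hMW : M ≤ C₁ * W := by
    refine le_of_pow_le_pow_left₀ hn0 (by positivity) ?_
    rw [hMV]
    refine le_of_mul_le_mul_right ?_ (pow_pos hW0 (k - D))
    rw [hVW]
    calc C₁ * z ^ (18 * k) ≤ C₁ ^ n * z ^ (14 * (k + D + 1)) := by
          gcongr ?_ * ?_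
          · exact le_self_pow₀ hC₁1 hn0
          · exact pow_le_pow_right₀ hz1 (by omega)
      _ = C₁ ^ n * (z ^ 14) ^ (k + D + 1) := by rw [pow_mul z 14]
      _ ≤ C₁ ^ n * W ^ (k + D + 1) := by gcongr
      _ = (C₁ * W) ^ n * W ^ (k - D) := by
        rw [mul_pow C₁ W, mul_assoc (C₁ ^ n), ← pow_add]; congr 2; omega
  have hWM : W * M ≤ Q * z ^ 28 := by
    refine le_of_pow_le_pow_left₀ hn0 (by positivity) ?_
    have h1 : W ^ (3 * D + 1) * z ^ (18 * k) ≤ c₁ ^ 2 * z ^ (28 * n) * W ^ k := by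
      have hc2 : 1 ≤ c₁ ^ 2 := one_le_pow₀ hc₁
      obtain h | h | h : k = 3 * D ∨ k = 3 * D + 1 ∨ k = 3 * D + 2 := by omega
      · calc W ^ (3 * D + 1) * z ^ (18 * k) = W * z ^ (18 * k) * W ^ k := by
              rw [← h, pow_succ]; ring
          _ ≤ (c₁ ^ 2 * z ^ 18) * z ^ (18 * k) * W ^ k := by gcongr
          _ = c₁ ^ 2 * z ^ (18 + 18 * k) * W ^ k := by rw [pow_add]; ring
          _ ≤ _ := by
            gcongr c₁ ^ 2 * ?_ * W ^ k
            exact pow_le_pow_right₀ hz1 (by omega)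
      · rw [← h, mul_comm]
        gcongr
        calc z ^ (18 * k) ≤ z ^ (28 * n) := pow_le_pow_right₀ hz1 (by omega)
          _ ≤ _ := le_mul_of_one_le_left (by positivity) hc2
      · have h2 : z ^ (18 * k) ≤ z ^ (28 * n) * W := by
          calc z ^ (18 * k) ≤ z ^ (28 * n + 14) := pow_le_pow_right₀ hz1 (by omega)
            _ = z ^ (28 * n) * z ^ 14 := pow_add _ _ _
            _ ≤ _ := by gcongr
        calc W ^ (3 * D + 1) * z ^ (18 * k) ≤ W ^ (3 * D + 1) * (z ^ (28 * n) * W) := by gcongr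
          _ = 1 * z ^ (28 * n) * W ^ k := by
            rw [show k = 3 * D + 1 + 1 by omega, pow_succ W (3 * D + 1)]; ring
          _ ≤ _ := by gcongr
    rw [mul_pow W M, hMV, mul_pow Q, ← pow_mul]
    refine le_of_mul_le_mul_right ?_ (pow_pos hW0 k)
    have h3 : W ^ k = W ^ (k - D) * W ^ D := by rw [← pow_add]; congr 1; omega
    calc W ^ n * V * W ^ k = (V * W ^ (k - D)) * (W ^ n * W ^ D) := by rw [h3]; ring
      _ = C₁ * (W ^ (3 * D + 1) * z ^ (18 * k)) := by
        rw [hVW, ← pow_add, show n + D = 3 * D + 1 by omega]; ring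
      _ ≤ C₁ * (c₁ ^ 2 * z ^ (28 * n) * W ^ k) := by gcongr
      _ = Q * z ^ (28 * n) * W ^ k := by rw [hQ]; ring
      _ ≤ _ := by
        gcongr
        exact le_self_pow₀ hQ1 hn0
  refine ⟨M, hM1, ?_, hXYM, hMZ, ?_, ?_⟩
  · have : ((k / 3 : ℕ) : ℝ) ≤ k := by exact_mod_cast Nat.div_le_self k 3
    linarith
  · rw [hMV, mul_comm (W ^ (k - D)), hVW, ← pow_mul, show 9 * k * 2 = 18 * k by ring]
    gcongr
  · have h1 : M ≤ Q * z ^ 14 := by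
      refine le_of_pow_le_pow_left₀ two_ne_zero (by positivity) ?_
      calc M ^ 2 = M * M := sq M
        _ ≤ C₁ * W * M := by gcongr
        _ = C₁ * (W * M) := by ring
        _ ≤ Q * (Q * z ^ 28) := by gcongr
        _ = _ := by ring
    have h2 : M * √(W / M) ≤ Q * z ^ 14 := by
      refine le_of_pow_le_pow_left₀ two_ne_zero (by positivity) ?_
      rw [mul_pow, Real.sq_sqrt (by positivity)]
      calc M ^ 2 * (W / M) = 1 * (W * M) := by field_simp
        _ ≤ Q * (Q * z ^ 28) := by gcongr
        _ = _ := by ring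
    rw [mul_add, mul_one]
    linarith

theorem card_le_of_card_arc_le {X Y M E : ℝ} (hX : 0 < X) (hY : 0 < Y) (hM : 1 ≤ M)
    (P : Finset (ℕ × ℕ × ℕ × ℕ))
    (hP : ∀ q ∈ P, X < q.2.2.1 ∧ (q.2.2.1 : ℝ) ≤ 2 * X ∧ Y < q.2.2.2 ∧ (q.2.2.2 : ℝ) ≤ 2 * Y)
    (harc : ∀ s : ℝ, 0 < s → ∀ P' ⊆ P, (∀ q ∈ P', ∃ θ : ℝ, |θ| ≤ 1 / M ∧
      (q.2.2.1 : ℝ) = s * Real.exp θ * q.2.2.2) → (P'.card : ℝ) ≤ E) :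
    (P.card : ℝ) ≤ 4 * M * E := by
  set r : ℕ × ℕ × ℕ × ℕ → ℝ := fun q => (q.2.2.1 : ℝ) / q.2.2.2 * (Y / X) with hr
  set f : ℕ × ℕ × ℕ × ℕ → ℤ := fun q => ⌊M * Real.log (r q)⌋ with hf
  set I : Finset ℤ := Finset.Icc ⌊-M⌋ ⌊M⌋ with hI
  have hE : 0 ≤ E := by simpa using harc 1 one_pos ∅ (Finset.empty_subset _) (by simp)
  have hr0 : ∀ q ∈ P, 0 < r q := by
    intro q hq
    obtain ⟨h1, -, h2, -⟩ := hP q hq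
    have : (0 : ℝ) < q.2.2.1 := by linarith
    have : (0 : ℝ) < q.2.2.2 := by linarith
    rw [hr]
    positivity
  have hlog : ∀ q ∈ P, -1 ≤ Real.log (r q) ∧ Real.log (r q) ≤ 1 := by
    intro q hq
    obtain ⟨h1, h2, h3, h4⟩ := hP q hq
    have hy : (0 : ℝ) < q.2.2.2 := by linarith
    have hru : r q ≤ 2 := by
      rw [hr]
      simp only
      rw [div_mul_div_comm, div_le_iff₀ (by positivity)]
      nlinarith
    have hrl : 1 / 2 ≤ r q := by
      rw [hr]
      simp only
      rw [div_mul_div_comm, le_div_iff₀ (by positivity)]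
      nlinarith
    have hl2 := Real.log_two_lt_d9
    constructor
    · have := Real.log_le_log (by norm_num) hrl
      rw [one_div, Real.log_inv] at this
      linarith
    · have := Real.log_le_log (hr0 q hq) hru
      linarith
  have hmem : ∀ q ∈ P, f q ∈ I := by
    intro q hq
    obtain ⟨h1, h2⟩ := hlog q hq
    rw [hI, Finset.mem_Icc]
    constructor <;> apply Int.floor_le_floor <;> nlinarith
  have hIcard : (I.card : ℝ) ≤ 4 * M := by
    have h0 : ⌊-M⌋ ≤ ⌊M⌋ := Int.floor_le_floor (by linarith)
    have h1 : ((I.card : ℤ) : ℝ) = ((⌊M⌋ + 1 - ⌊-M⌋ : ℤ) : ℝ) := by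
      rw [hI, Int.card_Icc, Int.toNat_of_nonneg]
      omega
    have h2 := Int.floor_le M
    have h3 := Int.lt_floor_add_one (-M)
    push_cast at h1
    linarith
  have hfib : ∀ j ∈ I, ((P.filter fun q => f q = j).card : ℝ) ≤ E := by
    intro j _
    apply harc (X / Y * Real.exp (j / M)) (by positivity) _ (Finset.filter_subset _ _)
    intro q hq
    rw [Finset.mem_filter] at hq
    obtain ⟨hq, hj⟩ := hq
    have hy : (0 : ℝ) < q.2.2.2 := hY.trans (hP q hq).2.2.1
    refine ⟨Real.log (r q) - j / M, ?_, ?_⟩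
    · have h1 := Int.floor_le (M * Real.log (r q))
      have h2 := Int.lt_floor_add_one (M * Real.log (r q))
      have h3 : Real.log (r q) - j / M = (M * Real.log (r q) - j) / M := by field_simp
      have h4 : (⌊M * Real.log (r q)⌋ : ℝ) = j := by exact_mod_cast hj
      rw [h4] at h1 h2
      rw [h3, abs_div, abs_of_pos (show 0 < M by linarith)]
      gcongr
      rw [abs_le]
      constructor <;> linarith
    · rw [mul_assoc (X / Y), ← Real.exp_add, add_sub_cancel, Real.exp_log (hr0 q hq), hr]
      field_simp
  calc (P.card : ℝ) = ∑ j ∈ I, ((P.filter fun q => f q = j).card : ℝ) := by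
        rw [Finset.card_eq_sum_card_fiberwise hmem]; push_cast; rfl
    _ ≤ ∑ j ∈ I, E := Finset.sum_le_sum hfib
    _ = I.card * E := by rw [Finset.sum_const, nsmul_eq_mul]
    _ ≤ _ := by gcongr

theorem IsSol.eq_of_snd_eq {k : ℕ} (hk : k ≠ 0) {X Y Z : ℝ} (hX : 0 < X) (hY : 0 < Y)
    (hZ : Z ≤ (X * Y) ^ k) {q q' : ℕ × ℕ × ℕ × ℕ} (h : IsSol k q) (h' : IsSol k q')
    (hx : X < q.2.2.1) (hy : Y < q.2.2.2) (hb : Z < (q.2.1 : ℝ) * (q.2.2.2 : ℝ) ^ k)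
    (hb2 : (q.2.1 : ℝ) * (q.2.2.2 : ℝ) ^ k ≤ 2 * Z)
    (hb' : Z < (q'.2.1 : ℝ) * (q'.2.2.2 : ℝ) ^ k)
    (hb2' : (q'.2.1 : ℝ) * (q'.2.2.2 : ℝ) ^ k ≤ 2 * Z) (hqq : q.2.2 = q'.2.2) : q = q' := by
  obtain ⟨a, b, x, y⟩ := q
  obtain ⟨a', b', x', y'⟩ := q'
  obtain ⟨rfl, rfl⟩ : x = x' ∧ y = y' := Prod.mk.inj hqq
  have hcop : IsCoprime ((x : ℤ) ^ k) ((y : ℤ) ^ k) := (h.isCoprime hk).pow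
  obtain ⟨-, -, hx0, hy0, he⟩ := h
  obtain ⟨-, -, -, -, he'⟩ := h'
  simp only at *
  have hdvd : (x : ℤ) ^ k ∣ (b : ℤ) - b' := by
    refine hcop.dvd_of_dvd_mul_right ⟨(a : ℤ) - a', ?_⟩
    linear_combination he' - he
  have hbb : (b : ℤ) - b' = 0 := by
    by_contra hne
    have h1 : (x : ℤ) ^ k ≤ |(b : ℤ) - b'| :=
      Int.le_of_dvd (abs_pos.2 hne) ((dvd_abs _ _).2 hdvd)
    have h2 : (x : ℝ) ^ k ≤ |(b : ℝ) - b'| := by exact_mod_cast h1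
    have h3 : |(b : ℝ) - b'| * (y : ℝ) ^ k < Z := by
      have hy0' : (0 : ℝ) ≤ (y : ℝ) ^ k := by positivity
      rw [← abs_of_nonneg hy0', ← abs_mul, sub_mul, abs_lt]
      constructor <;> linarith
    have h4 : (X * Y) ^ k ≤ ((x : ℝ) * y) ^ k := by gcongr
    rw [mul_pow (x : ℝ)] at h4
    have h5 : (x : ℝ) ^ k * (y : ℝ) ^ k ≤ |(b : ℝ) - b'| * (y : ℝ) ^ k := by gcongr
    linarith
  have hb0 : (b : ℤ) = b' := by linarith
  have ha0 : (a : ℤ) = a' := by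
    have hxk : ((x : ℤ) ^ k) ≠ 0 := pow_ne_zero _ (by exact_mod_cast hx0.ne')
    apply mul_right_cancel₀ hxk
    rw [hb0] at he
    linarith
  rw [Nat.cast_injective ha0, Nat.cast_injective hb0]

/-- A crude bound for `Ncount` that is uniform as long as `Z` stays bounded. -/
theorem Ncount_le_of_le {k : ℕ} {X Y Z R : ℝ}
    (hXR : 2 * X ≤ R) (hYR : 2 * Y ≤ R) (hZR : 2 * Z + 1 ≤ R) :
    Ncount k X Y Z ≤ (⌊R⌋₊ + 1) ^ 4 := by
  set I : Finset ℕ := Finset.range (⌊R⌋₊ + 1) with hI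
  have hmem : ∀ n : ℕ, (n : ℝ) ≤ R → n ∈ I := by
    intro n hn
    rw [hI, Finset.mem_range, Nat.lt_succ_iff]
    exact Nat.le_floor hn
  calc Ncount k X Y Z ≤ (↑(I ×ˢ I ×ˢ I ×ˢ I) : Set (ℕ × ℕ × ℕ × ℕ)).ncard := by
        refine Set.ncard_le_ncard ?_ (Finset.finite_toSet _)
        rintro ⟨a, b, x, y⟩ ⟨ha, hb, hx, hy, he, hX1, hX2, hY1, hY2, hZ1, hZ2⟩
        simp only at *
        have her : (a : ℝ) * (x : ℝ) ^ k - b * (y : ℝ) ^ k = 1 := by exact_mod_cast he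
        have hx1 : (1 : ℝ) ≤ (x : ℝ) ^ k := one_le_pow₀ (by exact_mod_cast hx)
        have hy1 : (1 : ℝ) ≤ (y : ℝ) ^ k := one_le_pow₀ (by exact_mod_cast hy)
        have ha1 : (a : ℝ) ≤ a * (x : ℝ) ^ k := le_mul_of_one_le_right (Nat.cast_nonneg _) hx1
        have hb1 : (b : ℝ) ≤ b * (y : ℝ) ^ k := le_mul_of_one_le_right (Nat.cast_nonneg _) hy1
        simp only [Finset.coe_product, Set.mem_prod, Finset.mem_coe]
        exact ⟨hmem a (by linarith), hmem b (by linarith), hmem x (by linarith),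
          hmem y (by linarith)⟩
    _ = _ := by
        rw [Set.ncard_coe_finset]
        simp only [Finset.card_product, hI, Finset.card_range]
        ring

theorem Ncount_le {k D : ℕ} (hD : D + 2 ≤ k) (B : ℝ) (hB : 1 ≤ B) (ε : ℝ) (hε : 0 < ε) :
    ∃ K L : ℝ, 1 ≤ K ∧ 1 ≤ L ∧ ∀ X Y Z M : ℝ,
      1 ≤ X → 1 ≤ Y → 1 ≤ Z → 1 ≤ M → (k + D : ℝ) ≤ M → X ≤ Y * M →
      X ^ k ≤ B * Z → Y ^ k ≤ B * Z → M ^ (2 * D + 1) ≤ Z →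
      L * Z ^ 2 ≤ (X * Y) ^ (k - D) * M ^ (2 * D + 1) → Z ≤ (X * Y) ^ k →
      (Ncount k X Y Z : ℝ) ≤ K * Z ^ ε * (M * (1 + √(X * Y / M))) := by
  obtain ⟨K, L, hK, hL, h⟩ := card_arc_le hD B hB ε hε
  refine ⟨4 * K, L, by linarith, hL, ?_⟩
  intro X Y Z M hX hY hZ hM hkM hXYM hXB hYB hMZ hLZ hZW
  rw [Ncount]
  set S := {q : ℕ × ℕ × ℕ × ℕ | 0 < q.1 ∧ 0 < q.2.1 ∧ 0 < q.2.2.1 ∧ 0 < q.2.2.2 ∧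
    (q.1 : ℤ) * (q.2.2.1 : ℤ) ^ k - (q.2.1 : ℤ) * (q.2.2.2 : ℤ) ^ k = 1 ∧
    X < (q.2.2.1 : ℝ) ∧ (q.2.2.1 : ℝ) ≤ 2 * X ∧
    Y < (q.2.2.2 : ℝ) ∧ (q.2.2.2 : ℝ) ≤ 2 * Y ∧
    Z < (q.2.1 : ℝ) * (q.2.2.2 : ℝ) ^ k ∧ (q.2.1 : ℝ) * (q.2.2.2 : ℝ) ^ k ≤ 2 * Z} with hS
  rcases S.finite_or_infinite with hfin | hinf
  swap
  · rw [hinf.ncard, Nat.cast_zero]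
    positivity
  rw [Set.ncard_eq_toFinset_card S hfin]
  have hmem : ∀ q ∈ hfin.toFinset, IsSol k q ∧ X < (q.2.2.1 : ℝ) ∧ (q.2.2.1 : ℝ) ≤ 2 * X ∧
      Y < (q.2.2.2 : ℝ) ∧ (q.2.2.2 : ℝ) ≤ 2 * Y ∧
      Z < (q.2.1 : ℝ) * (q.2.2.2 : ℝ) ^ k ∧ (q.2.1 : ℝ) * (q.2.2.2 : ℝ) ^ k ≤ 2 * Z := by
    intro q hq
    obtain ⟨h1, h2, h3, h4, h5, h6⟩ := hfin.mem_toFinset.1 hq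
    exact ⟨⟨h1, h2, h3, h4, h5⟩, h6⟩
  have hinj : Set.InjOn (fun q : ℕ × ℕ × ℕ × ℕ => q.2.2) hfin.toFinset := by
    intro q hq q' hq' hqq
    obtain ⟨h1, h2, -, h3, -, h4, h5⟩ := hmem q hq
    obtain ⟨h1', -, -, -, -, h4', h5'⟩ := hmem q' hq'
    exact h1.eq_of_snd_eq (by omega) (by linarith) (by linarith) hZW h1' h2 h3 h4 h5 h4' h5' hqq
  have hcard := card_le_of_card_arc_le (E := K * Z ^ ε * (1 + √(X * Y / M))) (by linarith : 0 < X)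
    (by linarith : 0 < Y) hM hfin.toFinset
    (fun q hq => by
      obtain ⟨-, h2, h3, h4, h5, -⟩ := hmem q hq
      exact ⟨h2, h3, h4, h5⟩)
    (fun s hs P' hP' hθ => by
      apply h X Y Z M s P' hX hY hZ hM hs hkM hXYM hXB hYB hMZ hLZ
        (hinj.mono (Finset.coe_subset.2 hP'))
      intro q hq
      obtain ⟨h1, h2, h3, h4, h5, -, h6⟩ := hmem q (hP' hq)
      exact ⟨h1, h2, h3, h4, h5, h6, hθ q hq⟩)
  refine hcard.trans (le_of_eq ?_)
  ring

theorem stmt_12 (k : ℕ) (hk : 2 ≤ k) (ε c₁ : ℝ) (hε : 0 < ε) (hc₁ : 1 ≤ c₁) :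
    ∃ C : ℝ, 0 < C ∧ ∀ Z X Y : ℝ,
      2 ≤ Z → 1 ≤ X → 1 ≤ Y → max X Y ≤ c₁ * Z ^ (1 / (k : ℝ)) →
      Z ^ (14 / (9 * (k : ℝ))) ≤ X * Y →
      (Ncount k X Y Z : ℝ) ≤ C * Z ^ (14 / (9 * (k : ℝ)) + ε) := by
  obtain ⟨K, L, hK, hL, hN⟩ := Ncount_le (show k / 3 + 2 ≤ k by omega) (c₁ ^ k)
    (one_le_pow₀ hc₁) ε hε
  obtain ⟨Q, hQ, hpar⟩ := exists_arc_parameter hk c₁ L hc₁ hL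
  set R : ℝ := 2 * c₁ * Q ^ 9 + 2 * Q ^ (9 * k) + 1 with hR
  refine ⟨K * Q + ((⌊R⌋₊ + 1) ^ 4 : ℕ), by positivity, ?_⟩
  intro Z X Y hZ hX hY hXY hW
  have hk0 : (k : ℝ) ≠ 0 := by positivity
  set z : ℝ := Z ^ (1 / (9 * (k : ℝ))) with hz
  have hz1 : 1 ≤ z := Real.one_le_rpow (by linarith) (by positivity)
  have hzpow : ∀ m : ℕ, Z ^ ((m : ℝ) / (9 * (k : ℝ))) = z ^ m := by
    intro m
    rw [hz, ← Real.rpow_natCast, ← Real.rpow_mul (by linarith)]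
    congr 1
    ring
  have hz14 : Z ^ (14 / (9 * (k : ℝ))) = z ^ 14 := by simpa using hzpow 14
  have hz9 : Z ^ (1 / (k : ℝ)) = z ^ 9 := by
    rw [← hzpow 9]
    congr 1
    push_cast
    field_simp
  have hzk : Z = z ^ (9 * k) := by
    rw [← hzpow (9 * k)]
    push_cast
    rw [div_self (by positivity), Real.rpow_one]
  rw [hz9] at hXY
  rw [hz14] at hW
  have hXz := (le_max_left _ _).trans hXY
  have hYz := (le_max_right _ _).trans hXY
  have hZε : 1 ≤ Z ^ ε := Real.one_le_rpow (by linarith) hε.le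
  have hz14' : 1 ≤ z ^ 14 := one_le_pow₀ hz1
  have hone : 1 ≤ z ^ 14 * Z ^ ε := one_le_mul_of_one_le_of_one_le hz14' hZε
  rw [Real.rpow_add (by linarith), hz14, add_mul]
  rcases le_total Q z with hQz | hzQ
  · obtain ⟨M, hM1, hkM, hXYM, hMZ, hLZ, hfin⟩ := hpar X Y z hX hY hQz hXz hYz hW
    rw [← hzk] at hMZ hLZ
    have hpow : ∀ T : ℝ, 1 ≤ T → T ≤ c₁ * z ^ 9 → T ^ k ≤ c₁ ^ k * Z := by
      intro T hT hTz
      calc T ^ k ≤ (c₁ * z ^ 9) ^ k := by gcongr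
        _ = c₁ ^ k * Z := by rw [mul_pow, ← pow_mul, ← hzk]
    have hZW : Z ≤ (X * Y) ^ k := by
      calc Z = z ^ (9 * k) := hzk
        _ ≤ z ^ (14 * k) := pow_le_pow_right₀ hz1 (by omega)
        _ = (z ^ 14) ^ k := pow_mul _ _ _
        _ ≤ _ := by gcongr
    have hmain := hN X Y Z M hX hY (by linarith) hM1 hkM hXYM (hpow X hX hXz) (hpow Y hY hYz)
      hMZ hLZ hZW
    have hrest : (0 : ℝ) ≤ ((⌊R⌋₊ + 1) ^ 4 : ℕ) * (z ^ 14 * Z ^ ε) := by positivity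
    calc (Ncount k X Y Z : ℝ) ≤ K * Z ^ ε * (M * (1 + √(X * Y / M))) := hmain
      _ ≤ K * Z ^ ε * (Q * z ^ 14) := by gcongr
      _ = K * Q * (z ^ 14 * Z ^ ε) := by ring
      _ ≤ _ := by linarith
  · have hzQ9 : c₁ * z ^ 9 ≤ c₁ * Q ^ 9 := by gcongr
    have hZQ : Z ≤ Q ^ (9 * k) := by rw [hzk]; gcongr
    have hQ9 : 0 ≤ c₁ * Q ^ 9 := by positivity
    have hQ9k : 0 ≤ Q ^ (9 * k) := by positivity
    have hcrude : Ncount k X Y Z ≤ (⌊R⌋₊ + 1) ^ 4 :=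
      Ncount_le_of_le (by linarith) (by linarith) (by linarith)
    calc (Ncount k X Y Z : ℝ) ≤ ((⌊R⌋₊ + 1) ^ 4 : ℕ) := by exact_mod_cast hcrude
      _ ≤ ((⌊R⌋₊ + 1) ^ 4 : ℕ) * (z ^ 14 * Z ^ ε) :=
        le_mul_of_one_le_right (Nat.cast_nonneg _) hone
      _ ≤ _ := le_add_of_nonneg_left (by positivity)
end

section
/- Let u, v be real numbers with u ≤ v, v ≤ 1 and u + v ≥ 14/9. Then u + (9/4)·(1−u)·v ≤ 14/9, with equality at (u,v) = (5/9, 1). -/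
theorem stmt_13 (u v : ℝ) (h1 : u ≤ v) (h2 : v ≤ 1) (h3 : 14 / 9 ≤ u + v) :
    u + 9 / 4 * (1 - u) * v ≤ 14 / 9 ∧
    (5 / 9 : ℝ) + 9 / 4 * (1 - 5 / 9) * 1 = 14 / 9 := by
  have h : 0 ≤ (1 - u) * (1 - v) :=
    mul_nonneg (sub_nonneg.2 (h1.trans h2)) (sub_nonneg.2 h2)
  exact ⟨by linarith, by norm_num⟩
end

section
/- There is an absolute constant C > 0 such that for all real α, β, γ > 0, the sum ∑ (j·α + l·β), taken over all pairs (j,l) of nonnegative integers with j·α + l·β ≤ γ, differs from γ³/(3αβ) by at most C·( γ²/α + γ²/β + γ ). -/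
theorem tsum_lattice_triangle_eq {α β γ : ℝ} (hα : 0 < α) (hβ : 0 < β) (hγ : 0 < γ)
    (f : ℕ × ℕ → ℝ) :
    ∑' p : {p : ℕ × ℕ // (p.1 : ℝ) * α + (p.2 : ℝ) * β ≤ γ}, f p =
      ∑ j ∈ Finset.range (⌊γ / α⌋₊ + 1),
        ∑ l ∈ Finset.range (⌊(γ - j * α) / β⌋₊ + 1), f (j, l) := by
  set s := Finset.range (⌊γ / α⌋₊ + 1)
  set t : ℕ → Finset ℕ := fun j => Finset.range (⌊(γ - j * α) / β⌋₊ + 1) with ht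
  set r : Finset (ℕ × ℕ) := (s.sigma t).map (Equiv.sigmaEquivProd ℕ ℕ).toEmbedding with hr
  have mem_r (p : ℕ × ℕ) : p ∈ r ↔ p.1 ∈ s ∧ p.2 ∈ t p.1 := by
    simp [hr, Finset.mem_map_equiv]
  have mem_iff (p : ℕ × ℕ) : (p.1 : ℝ) * α + (p.2 : ℝ) * β ≤ γ ↔ p ∈ r := by
    rw [mem_r, Finset.mem_range, ht, Finset.mem_range, Nat.lt_succ_iff, Nat.lt_succ_iff,
      Nat.le_floor_iff (by positivity), le_div_iff₀ hα]
    have h1 : 0 ≤ (p.2 : ℝ) * β := by positivity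
    constructor
    · intro h
      have h2 : (p.1 : ℝ) * α ≤ γ := by linarith
      refine ⟨h2, ?_⟩
      rw [Nat.le_floor_iff (div_nonneg (by linarith) hβ.le), le_div_iff₀ hβ]
      linarith
    · rintro ⟨h2, h3⟩
      rw [Nat.le_floor_iff (div_nonneg (by linarith) hβ.le), le_div_iff₀ hβ] at h3
      linarith
  rw [← Finset.sum_finset_product r s t mem_r, ← Finset.tsum_subtype]
  exact (Equiv.subtypeEquivRight mem_iff).tsum_eq (fun p : {p // p ∈ r} => f p)

theorem sum_range_add_mul (a b : ℝ) (n : ℕ) :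
    ∑ l ∈ Finset.range (n + 1), (a + l * b) = (n + 1) * a + b * (n * (n + 1)) / 2 := by
  induction n with
  | zero => simp
  | succ n ih => rw [Finset.sum_range_succ, ih]; push_cast; ring

theorem sum_range_sq_sub_sq (s : ℝ) (n : ℕ) :
    ∑ j ∈ Finset.range (n + 1), (s ^ 2 - (j : ℝ) ^ 2) =
      (n + 1) * s ^ 2 - n * (n + 1) * (2 * n + 1) / 6 := by
  induction n with
  | zero => simp
  | succ n ih => rw [Finset.sum_range_succ, ih]; push_cast; ring

theorem abs_row_sum_sub_le {a β R : ℝ} (ha : 0 ≤ a) (hβ : 0 < β) (hR : 0 ≤ R) :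
    |∑ l ∈ Finset.range (⌊R / β⌋₊ + 1), (a + l * β) - (a * R / β + R ^ 2 / (2 * β))| ≤
      a + R := by
  rw [sum_range_add_mul]
  have ht0 : 0 ≤ R / β := div_nonneg hR hβ.le
  have h1 := Nat.floor_le ht0
  have h2 := Nat.lt_floor_add_one (R / β)
  have hL : (0 : ℝ) ≤ ⌊R / β⌋₊ := Nat.cast_nonneg _
  generalize (⌊R / β⌋₊ : ℝ) = L at *
  obtain ⟨t, rfl⟩ : ∃ t, R = t * β := ⟨R / β, by field_simp⟩
  rw [mul_div_cancel_right₀ _ hβ.ne'] at *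
  have e : (L + 1) * a + β * (L * (L + 1)) / 2 - (a * (t * β) / β + (t * β) ^ 2 / (2 * β)) =
      a * (L + 1 - t) + β * ((L * (L + 1) - t ^ 2) / 2) := by
    field_simp
    ring
  have b1 : 0 ≤ a * (L + 1 - t) := mul_nonneg ha (by linarith)
  have b2 : a * (L + 1 - t) ≤ a * 1 := mul_le_mul_of_nonneg_left (by linarith) ha
  have b3 : β * ((L * (L + 1) - t ^ 2) / 2) ≤ β * t :=
    mul_le_mul_of_nonneg_left (by nlinarith) hβ.le
  have b4 : β * (-t) ≤ β * ((L * (L + 1) - t ^ 2) / 2) :=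
    mul_le_mul_of_nonneg_left (by nlinarith) hβ.le
  rw [e, abs_le]
  constructor <;> linarith

theorem abs_sum_sq_sub_sq_sub_le {s : ℝ} (hs : 0 ≤ s) :
    |∑ j ∈ Finset.range (⌊s⌋₊ + 1), (s ^ 2 - (j : ℝ) ^ 2) - 2 / 3 * s ^ 3| ≤ s ^ 2 := by
  rw [sum_range_sq_sub_sq]
  have h1 := Nat.floor_le hs
  have h2 := Nat.lt_floor_add_one s
  generalize ⌊s⌋₊ = n at *
  have hn : (0 : ℝ) ≤ n := Nat.cast_nonneg _
  have hnn : (n : ℝ) ≤ n ^ 2 := by exact_mod_cast Nat.le_self_pow two_ne_zero n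
  generalize (n : ℝ) = J at *
  obtain ⟨f, rfl⟩ : ∃ f, s = J + f := ⟨s - J, by ring⟩
  have hf0 : 0 ≤ f := by linarith
  have hf1 : f ≤ 1 := by linarith
  have e : (J + 1) * (J + f) ^ 2 - J * (J + 1) * (2 * J + 1) / 6 - 2 / 3 * (J + f) ^ 3 =
      J ^ 2 / 2 + J * (2 * f - f ^ 2 - 1 / 6) + (f ^ 2 - 2 / 3 * f ^ 3) := by ring
  have c1 : 0 ≤ f ^ 2 * (1 - f) := mul_nonneg (sq_nonneg f) (by linarith)
  have c2 : 0 ≤ J * (f * (1 - f)) := mul_nonneg hn (mul_nonneg hf0 (by linarith))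
  have c3 : 0 ≤ J * f := mul_nonneg hn hf0
  have c4 : 0 ≤ f ^ 3 := by positivity
  have c5 : 0 ≤ J * f ^ 2 := by positivity
  rw [e, abs_le]
  constructor <;> nlinarith

theorem stmt_17 :
    ∃ C : ℝ, 0 < C ∧ ∀ α β γ : ℝ, 0 < α → 0 < β → 0 < γ →
      |(∑' p : {p : ℕ × ℕ // (p.1 : ℝ) * α + (p.2 : ℝ) * β ≤ γ},
          ((p.1.1 : ℝ) * α + (p.1.2 : ℝ) * β))
          - γ ^ 3 / (3 * α * β)| ≤ C * (γ ^ 2 / α + γ ^ 2 / β + γ) := by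
  refine ⟨1, one_pos, fun α β γ hα hβ hγ => ?_⟩
  rw [tsum_lattice_triangle_eq hα hβ hγ fun p => (p.1 : ℝ) * α + (p.2 : ℝ) * β]
  have hs : 0 ≤ γ / α := by positivity
  have rows : |∑ j ∈ Finset.range (⌊γ / α⌋₊ + 1),
      (∑ l ∈ Finset.range (⌊(γ - j * α) / β⌋₊ + 1), ((j : ℝ) * α + l * β) -
        α ^ 2 / (2 * β) * ((γ / α) ^ 2 - (j : ℝ) ^ 2))| ≤ γ ^ 2 / α + γ := by
    calc _ ≤ ∑ j ∈ Finset.range (⌊γ / α⌋₊ + 1), γ := by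
          refine (Finset.abs_sum_le_sum_abs _ _).trans (Finset.sum_le_sum fun j hj => ?_)
          rw [Finset.mem_range, Nat.lt_succ_iff, Nat.le_floor_iff hs, le_div_iff₀ hα] at hj
          have h := abs_row_sum_sub_le (a := j * α) (by positivity) hβ (sub_nonneg.2 hj)
          have e : α ^ 2 / (2 * β) * ((γ / α) ^ 2 - (j : ℝ) ^ 2) =
              j * α * (γ - j * α) / β + (γ - j * α) ^ 2 / (2 * β) := by
            field_simp
            ring
          rwa [← e, add_sub_cancel] at h
      _ = (⌊γ / α⌋₊ + 1) * γ := by simp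
      _ ≤ (γ / α + 1) * γ := by gcongr; exact Nat.floor_le hs
      _ = γ ^ 2 / α + γ := by ring
  have columns : |α ^ 2 / (2 * β) * (∑ j ∈ Finset.range (⌊γ / α⌋₊ + 1),
      ((γ / α) ^ 2 - (j : ℝ) ^ 2) - 2 / 3 * (γ / α) ^ 3)| ≤ γ ^ 2 / β := by
    rw [abs_mul, abs_of_pos (by positivity)]
    calc _ ≤ α ^ 2 / (2 * β) * (γ / α) ^ 2 := by
          gcongr
          exact abs_sum_sq_sub_sq_sub_le hs
      _ = γ ^ 2 / β / 2 := by field_simp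
      _ ≤ γ ^ 2 / β := half_le_self (by positivity)
  have main_term : α ^ 2 / (2 * β) * (2 / 3 * (γ / α) ^ 3) = γ ^ 3 / (3 * α * β) := by
    field_simp
  rw [Finset.sum_sub_distrib, ← Finset.mul_sum] at rows
  rw [mul_sub, main_term] at columns
  rw [abs_le] at *
  constructor <;> linarith [rows.1, rows.2, columns.1, columns.2]
end
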